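/- arXiv:1405.5853 — 4 statements merged into one kernel-verified Lean document; each statement's English description precedes it below -/
import Mathlib

section
/- Let b, c ≥ 0 be real numbers such that the point (b, c) lies in the convex hull of the four points (0, 0), (0, 3(√2 − 1)), (6/5, 6/5), and (3(√2 − 1), 0); that is, there exist nonnegative reals t₁, t₂, t₃, t₄ with t₁+t₂+t₃+t₄ = 1, b = t₃·(6/5) + t₄·3(√2−1), and c = t₂·3(√2−1) + t₃·(6/5). Then for every absolutely PPT density matrix ρ on ℂ³ ⊗ ℂ³, the matrix (id_3 ⊗ Φ_{b,c})(ρ) is positive semidefinite. -/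
open Matrix BigOperators
open scoped ComplexOrder

noncomputable section

/-- The generalized Choi map `Φ_{b,c} : M₃(ℂ) → M₃(ℂ)` (with `a = 2 - b - c`). -/
def PhiG (b c : ℝ) (X : Matrix (Fin 3) (Fin 3) ℂ) : Matrix (Fin 3) (Fin 3) ℂ :=
  (1 / 2 : ℂ) •
    !![((2 - b - c : ℝ) : ℂ) * X 0 0 + (b : ℂ) * X 1 1 + (c : ℂ) * X 2 2,
         -(X 0 1), -(X 0 2);
       -(X 1 0),
         (c : ℂ) * X 0 0 + ((2 - b - c : ℝ) : ℂ) * X 1 1 + (b : ℂ) * X 2 2,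
         -(X 1 2);
       -(X 2 0), -(X 2 1),
         (b : ℂ) * X 0 0 + (c : ℂ) * X 1 1 + ((2 - b - c : ℝ) : ℂ) * X 2 2]

/-- The map `id_n ⊗ Φ`, acting blockwise on an `n² × n²` matrix indexed by
`Fin n × Fin n`. -/
def idTensor {n : ℕ} (Φ : Matrix (Fin n) (Fin n) ℂ → Matrix (Fin n) (Fin n) ℂ)
    (X : Matrix (Fin n × Fin n) (Fin n × Fin n) ℂ) :
    Matrix (Fin n × Fin n) (Fin n × Fin n) ℂ :=
  Matrix.of fun p q => Φ (Matrix.of fun k l => X (p.1, k) (q.1, l)) p.2 q.2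

/-- The partial transpose (on the second factor) of a matrix indexed by `Fin m × Fin n`. -/
def partialTranspose {m n : ℕ} (X : Matrix (Fin m × Fin n) (Fin m × Fin n) ℂ) :
    Matrix (Fin m × Fin n) (Fin m × Fin n) ℂ :=
  Matrix.of fun p q => X (p.1, q.2) (q.1, p.2)

/-- A state is absolutely PPT if every unitary conjugate has positive semidefinite
partial transpose. -/
def AbsolutelyPPT {m n : ℕ} (ρ : Matrix (Fin m × Fin n) (Fin m × Fin n) ℂ) : Prop :=
  ∀ U : Matrix (Fin m × Fin n) (Fin m × Fin n) ℂ,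
    U ∈ Matrix.unitaryGroup (Fin m × Fin n) ℂ →
      (partialTranspose (U * ρ * Uᴴ)).PosSemidef

/-- A positive semidefinite matrix is diagonalized by a unitary whose columns are
ordered so that `(0, 0)`, `(0, 1)`, `(1, 1)` carry the three smallest eigenvalues and `(1, 0)` the
largest one. -/
lemma exists_sorted_diagonalization {ρ : Matrix (Fin 3 × Fin 3) (Fin 3 × Fin 3) ℂ}
    (hρ : ρ.PosSemidef) :
    ∃ V ∈ Matrix.unitaryGroup (Fin 3 × Fin 3) ℂ, ∃ d : Fin 3 × Fin 3 → ℝ,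
      ρ = V * diagonal (fun i => (d i : ℂ)) * Vᴴ ∧ (∀ i, 0 ≤ d i) ∧
      d (0, 0) ≤ d (0, 1) ∧ d (0, 1) ≤ d (1, 1) ∧
      (∀ i, i ≠ (0, 0) → i ≠ (0, 1) → d (1, 1) ≤ d i) ∧ (∀ i, d i ≤ d (1, 0)) := by
  obtain ⟨g, hg0, hg1, hg2, hg8⟩ : ∃ g : Fin 9 ≃ Fin 3 × Fin 3,
      g 0 = (0, 0) ∧ g 1 = (0, 1) ∧ g 2 = (1, 1) ∧ g 8 = (1, 0) := by
    refine ⟨(finProdFinEquiv (m := 3) (n := 3)).symm.trans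
      ((Equiv.swap (0, 2) (1, 1)).trans (Equiv.swap (2, 2) (1, 0))), ?_, ?_, ?_, ?_⟩ <;> decide
  let W : Matrix (Fin 3 × Fin 3) (Fin 3 × Fin 3) ℂ := hρ.1.eigenvectorUnitary.1
  have hWu : W ∈ Matrix.unitaryGroup (Fin 3 × Fin 3) ℂ := hρ.1.eigenvectorUnitary.2
  let f : Fin 9 → ℝ := fun m => hρ.1.eigenvalues (g m)
  let σ : Equiv.Perm (Fin 3 × Fin 3) := (g.symm.trans (Tuple.sort f)).trans g
  have hd : ∀ m, hρ.1.eigenvalues (σ (g m)) = f (Tuple.sort f m) := by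
    intro m; simp [σ, f]
  have hmono : ∀ m n, m ≤ n → hρ.1.eigenvalues (σ (g m)) ≤ hρ.1.eigenvalues (σ (g n)) := by
    intro m n hmn
    rw [hd, hd]
    exact Tuple.monotone_sort f hmn
  have hspec : ρ = W * diagonal (fun i => (hρ.1.eigenvalues i : ℂ)) * Wᴴ := by
    conv_lhs => rw [hρ.1.spectral_theorem, Unitary.conjStarAlgAut_apply]
    rfl
  have hsurj : ∀ i, ∃ m, g m = i := g.surjective
  refine ⟨W.submatrix id σ, ?_, fun i => hρ.1.eigenvalues (σ i), ?_, fun i =>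
    hρ.eigenvalues_nonneg _, ?_, ?_, ?_, ?_⟩
  · rw [mem_unitaryGroup_iff, star_eq_conjTranspose, conjTranspose_submatrix,
      submatrix_mul_equiv, submatrix_id_id]
    exact mem_unitaryGroup_iff.1 hWu
  · have : diagonal (fun i => (hρ.1.eigenvalues (σ i) : ℂ))
        = (diagonal (fun i => (hρ.1.eigenvalues i : ℂ))).submatrix σ σ := by
      rw [submatrix_diagonal_equiv]; rfl
    rw [this, conjTranspose_submatrix, submatrix_mul_equiv, submatrix_mul_equiv, submatrix_id_id]
    exact hspec
  · simpa only [hg0, hg1] using hmono 0 1 (by decide)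
  · simpa only [hg1, hg2] using hmono 1 2 (by decide)
  · intro i h0 h1
    obtain ⟨m, rfl⟩ := hsurj i
    have h0' : m ≠ 0 := fun h => h0 (by rw [h, hg0])
    have h1' : m ≠ 1 := fun h => h1 (by rw [h, hg1])
    simpa only [hg2] using hmono 2 m (by omega)
  · intro i
    obtain ⟨m, rfl⟩ := hsurj i
    simpa only [hg8] using hmono m 8 (by omega)

/-- The unitary on `ℂ³ ⊗ ℂ³` which is a Hadamard rotation on the span of `e₀ ⊗ e₁` and `e₁ ⊗ e₀`
and the identity on its orthogonal complement. -/
def hadamard01 : Matrix (Fin 3 × Fin 3) (Fin 3 × Fin 3) ℂ :=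
  Matrix.of fun p q =>
    if p = (0, 1) ∧ q = (0, 1) ∨ p = (0, 1) ∧ q = (1, 0) ∨ p = (1, 0) ∧ q = (0, 1) then
      ((Real.sqrt 2 / 2 : ℝ) : ℂ)
    else if p = (1, 0) ∧ q = (1, 0) then -((Real.sqrt 2 / 2 : ℝ) : ℂ)
    else if p = q then 1 else 0

lemma sqrt_two_half_mul_self :
    ((Real.sqrt 2 / 2 : ℝ) : ℂ) * ((Real.sqrt 2 / 2 : ℝ) : ℂ) = 1 / 2 := by
  rw [← Complex.ofReal_mul, div_mul_div_comm, Real.mul_self_sqrt (by norm_num)]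
  norm_num

lemma hadamard01_conjTranspose : hadamard01ᴴ = hadamard01 := by
  ext p q
  fin_cases p <;> fin_cases q <;> simp [hadamard01]

lemma hadamard01_mul_self : hadamard01 * hadamard01 = 1 := by
  have h := sqrt_two_half_mul_self
  ext p q
  rw [mul_apply]
  fin_cases p <;> fin_cases q <;>
    simp [hadamard01, Fintype.sum_prod_type, Fin.sum_univ_three, one_apply,
      -Complex.ofReal_div, h] <;>
    norm_num

/-- The eigenvalues of an absolutely PPT state satisfy the inequality obtained from a rotated
state whose partial transpose is tested on the vector `s e₀ ⊗ e₀ + t e₁ ⊗ e₁`. -/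
lemma AbsolutelyPPT.eigenvalue_inequality {ρ V : Matrix (Fin 3 × Fin 3) (Fin 3 × Fin 3) ℂ}
    {d : Fin 3 × Fin 3 → ℝ} (hρ : AbsolutelyPPT ρ)
    (hV : V ∈ Matrix.unitaryGroup (Fin 3 × Fin 3) ℂ)
    (hd : ρ = V * diagonal (fun i => (d i : ℂ)) * Vᴴ) (s t : ℝ) :
    0 ≤ s ^ 2 * d (0, 0) + s * t * d (0, 1) + t ^ 2 * d (1, 1) - s * t * d (1, 0) := by
  have hV' : Vᴴ * V = 1 := mem_unitaryGroup_iff'.1 hV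
  have hU : hadamard01 * Vᴴ ∈ Matrix.unitaryGroup (Fin 3 × Fin 3) ℂ := by
    rw [mem_unitaryGroup_iff', star_eq_conjTranspose, conjTranspose_mul, hadamard01_conjTranspose,
      conjTranspose_conjTranspose, Matrix.mul_assoc, ← Matrix.mul_assoc hadamard01,
      hadamard01_mul_self, Matrix.one_mul]
    exact mem_unitaryGroup_iff.1 hV
  have hrot : hadamard01 * Vᴴ * ρ * (hadamard01 * Vᴴ)ᴴ
      = hadamard01 * diagonal (fun i => (d i : ℂ)) * hadamard01 := by
    rw [conjTranspose_mul, hadamard01_conjTranspose, conjTranspose_conjTranspose, hd]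
    calc _ = hadamard01 * ((Vᴴ * V) * diagonal (fun i => (d i : ℂ)) * (Vᴴ * V)) * hadamard01 := by
          simp only [Matrix.mul_assoc]
      _ = _ := by rw [hV', Matrix.one_mul, Matrix.mul_one]
  have h := (hρ _ hU).dotProduct_mulVec_nonneg
    (fun p => if p = (0, 0) then (s : ℂ) else if p = (1, 1) then (t : ℂ) else 0)
  rw [hrot] at h
  have key : star (fun p : Fin 3 × Fin 3 =>
        if p = (0, 0) then (s : ℂ) else if p = (1, 1) then (t : ℂ) else 0) ⬝ᵥ
      partialTranspose (hadamard01 * diagonal (fun i => (d i : ℂ)) * hadamard01) *ᵥ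
        (fun p => if p = (0, 0) then (s : ℂ) else if p = (1, 1) then (t : ℂ) else 0)
      = ((s ^ 2 * d (0, 0) + s * t * d (0, 1) + t ^ 2 * d (1, 1) - s * t * d (1, 0) : ℝ) : ℂ) := by
    have hh := sqrt_two_half_mul_self
    simp [dotProduct, mulVec, partialTranspose, mul_apply, Fintype.sum_prod_type,
      Fin.sum_univ_three, diagonal_apply, hadamard01, -Complex.ofReal_div]
    linear_combination (2 * s * t * d (0, 1) - 2 * s * t * d (1, 0) : ℂ) * hh
  rw [key] at h
  exact_mod_cast h

/-- The vector `ψ_k ⊗ e_l`, where `ψ = ∑ k, ψ_k ⊗ e_k`. -/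
def colTensor (ψ : Fin 3 × Fin 3 → ℂ) (k l : Fin 3) : Fin 3 × Fin 3 → ℂ :=
  fun p => if p.2 = l then ψ (p.1, k) else 0

/-- The circulant matrix of weights of the diagonal part of `Φ_{b,c}`, shifted by the identity. -/
def choiWeight (b c : ℝ) : Matrix (Fin 3) (Fin 3) ℝ :=
  !![3 - b - c, b, c; c, 3 - b - c, b; b, c, 3 - b - c]

lemma dotProduct_idTensor_PhiG (b c : ℝ) (X : Matrix (Fin 3 × Fin 3) (Fin 3 × Fin 3) ℂ)
    (ψ : Fin 3 × Fin 3 → ℂ) :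
    star ψ ⬝ᵥ idTensor (PhiG b c) X *ᵥ ψ =
      1 / 2 * (∑ k, ∑ l, (choiWeight b c k l : ℂ) *
        (star (colTensor ψ k l) ⬝ᵥ X *ᵥ colTensor ψ k l) - star ψ ⬝ᵥ X *ᵥ ψ) := by
  simp [dotProduct, mulVec, idTensor, PhiG, colTensor, choiWeight, Fintype.sum_prod_type,
    Fin.sum_univ_three]
  ring

lemma isHermitian_idTensor_PhiG (b c : ℝ) {X : Matrix (Fin 3 × Fin 3) (Fin 3 × Fin 3) ℂ}
    (hX : X.IsHermitian) : (idTensor (PhiG b c) X).IsHermitian := by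
  have hPhi : ∀ (Y : Matrix (Fin 3) (Fin 3) ℂ) (k l : Fin 3),
      star (PhiG b c Y k l) = PhiG b c Yᴴ l k := by
    intro Y k l
    fin_cases k <;> fin_cases l <;> simp [PhiG]
  refine IsHermitian.ext fun p q => ?_
  simp only [idTensor, of_apply, hPhi]
  congr 1
  ext k l
  simp [hX.apply]

lemma dotProduct_diagonalization {n : Type*} [Fintype n] [DecidableEq n] (V : Matrix n n ℂ)
    (d : n → ℝ) (w : n → ℂ) :
    star w ⬝ᵥ (V * diagonal (fun i => (d i : ℂ)) * Vᴴ) *ᵥ w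
      = ((∑ m, d m * ‖(Vᴴ *ᵥ w) m‖ ^ 2 : ℝ) : ℂ) := by
  have h : star w ᵥ* V = star (Vᴴ *ᵥ w) := by
    rw [star_mulVec, conjTranspose_conjTranspose]
  rw [← mulVec_mulVec, ← mulVec_mulVec, dotProduct_mulVec, h]
  generalize Vᴴ *ᵥ w = u
  push_cast
  refine Finset.sum_congr rfl fun m _ => ?_
  rw [mulVec_diagonal, ← Complex.mul_conj']
  simp only [Pi.star_apply, RCLike.star_def]
  ring

lemma sum_norm_sq_conjTranspose_mulVec {n : Type*} [Fintype n] [DecidableEq n] {V : Matrix n n ℂ}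
    (hV : V ∈ Matrix.unitaryGroup n ℂ) (w : n → ℂ) :
    ∑ m, ‖(Vᴴ *ᵥ w) m‖ ^ 2 = ∑ m, ‖w m‖ ^ 2 := by
  have hsq : ∀ u : n → ℂ, ((∑ m, ‖u m‖ ^ 2 : ℝ) : ℂ) = star u ⬝ᵥ u := by
    intro u
    push_cast
    refine Finset.sum_congr rfl fun m _ => ?_
    rw [← Complex.conj_mul']
    rfl
  have h : ((∑ m, ‖(Vᴴ *ᵥ w) m‖ ^ 2 : ℝ) : ℂ) = ((∑ m, ‖w m‖ ^ 2 : ℝ) : ℂ) := by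
    rw [hsq, hsq, star_mulVec, conjTranspose_conjTranspose, ← dotProduct_mulVec, mulVec_mulVec,
      ← star_eq_conjTranspose, mem_unitaryGroup_iff.1 hV, one_mulVec]
  exact_mod_cast h

lemma sum_norm_sq_colTensor (ψ : Fin 3 × Fin 3 → ℂ) (k l : Fin 3) :
    ∑ p, ‖colTensor ψ k l p‖ ^ 2 = ∑ i, ‖ψ (i, k)‖ ^ 2 := by
  rw [Fintype.sum_prod_type]
  refine Finset.sum_congr rfl fun i _ => ?_
  rw [Finset.sum_eq_single l] <;> simp +contextual [colTensor]

lemma sum_colTensor_diag (ψ : Fin 3 × Fin 3 → ℂ) : ∑ k, colTensor ψ k k = ψ := by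
  ext ⟨i, j⟩
  simp [colTensor]

lemma norm_sq_conjTranspose_mulVec_colTensor_le (V : Matrix (Fin 3 × Fin 3) (Fin 3 × Fin 3) ℂ)
    (ψ : Fin 3 × Fin 3 → ℂ) (k l : Fin 3) (m : Fin 3 × Fin 3) :
    ‖(Vᴴ *ᵥ colTensor ψ k l) m‖ ^ 2 ≤ (∑ i, ‖ψ (i, k)‖ ^ 2) * ∑ i, ‖V (i, l) m‖ ^ 2 := by
  have h : (Vᴴ *ᵥ colTensor ψ k l) m = ∑ i, ψ (i, k) * star (V (i, l) m) := by
    simp [mulVec, dotProduct, colTensor, Fintype.sum_prod_type, mul_comm]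
  rw [h]
  calc _ ≤ (∑ i, ‖ψ (i, k)‖ * ‖V (i, l) m‖) ^ 2 := by
        gcongr
        refine (norm_sum_le _ _).trans_eq ?_
        simp
    _ ≤ _ := Finset.sum_mul_sq_le_sq_mul_sq _ _ _

lemma sum_norm_sq_col_eq_one {V : Matrix (Fin 3 × Fin 3) (Fin 3 × Fin 3) ℂ}
    (hV : V ∈ Matrix.unitaryGroup (Fin 3 × Fin 3) ℂ) (m : Fin 3 × Fin 3) :
    ∑ l, ∑ i, ‖V (i, l) m‖ ^ 2 = 1 := by
  have h : (Vᴴ * V) m m = 1 := by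
    rw [← star_eq_conjTranspose, mem_unitaryGroup_iff'.1 hV, one_apply_eq]
  have h' : ((∑ p, ‖V p m‖ ^ 2 : ℝ) : ℂ) = 1 := by
    rw [← h, mul_apply]
    push_cast
    refine Finset.sum_congr rfl fun p _ => ?_
    rw [← Complex.conj_mul']
    rfl
  rw [Finset.sum_comm, ← Fintype.sum_prod_type (f := fun p => ‖V p m‖ ^ 2)]
  exact_mod_cast h'

lemma sum_mul_ge_of_le_off {ι : Type*} [Fintype ι] [DecidableEq ι] (s : Finset ι) {d Q : ι → ℝ}
    {τ : ℝ} (hQ : ∀ m, 0 ≤ Q m) (hd : ∀ m ∉ s, τ ≤ d m) :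
    τ * ∑ m, Q m + ∑ m ∈ s, (d m - τ) * Q m ≤ ∑ m, d m * Q m := by
  have h : ∑ m, (d m - τ) * Q m = ∑ m, d m * Q m - τ * ∑ m, Q m := by
    simp only [sub_mul, Finset.sum_sub_distrib, Finset.mul_sum]
  have h' : ∑ m ∈ s, (d m - τ) * Q m ≤ ∑ m, (d m - τ) * Q m :=
    Finset.sum_le_sum_of_subset_of_nonneg (Finset.subset_univ s) fun m _ hm =>
      mul_nonneg (sub_nonneg.2 (hd m hm)) (hQ m)
  linarith

lemma norm_sq_sum_three_le (u : Fin 3 → ℂ) : ‖∑ k, u k‖ ^ 2 ≤ 3 * ∑ k, ‖u k‖ ^ 2 := by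
  calc ‖∑ k, u k‖ ^ 2 ≤ (∑ k, ‖u k‖) ^ 2 := by
        gcongr
        exact norm_sum_le _ _
    _ ≤ 3 * ∑ k, ‖u k‖ ^ 2 := by
        simpa using sq_sum_le_card_mul_sum_sq (s := Finset.univ) (f := fun k => ‖u k‖)

lemma sum_norm_sq_sub_norm_sum_sq_le_of_max {u₀ u₁ u₂ : ℂ} {n : ℝ}
    (h₁ : ‖u₁‖ ≤ ‖u₀‖) (h₂ : ‖u₂‖ ≤ ‖u₀‖) (hn : ‖u₀‖ + ‖u₁‖ + ‖u₂‖ ≤ n) :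
    (9 - 6 * Real.sqrt 2) * (‖u₀‖ ^ 2 + ‖u₁‖ ^ 2 + ‖u₂‖ ^ 2)
      ≤ (2 - Real.sqrt 2) * ‖u₀ + u₁ + u₂‖ ^ 2 + (4 - 5 * Real.sqrt 2 / 2) * n ^ 2 := by
  have hg : ‖u₀‖ - ‖u₁‖ - ‖u₂‖ ≤ ‖u₀ + u₁ + u₂‖ := by
    have e : u₀ = (u₀ + u₁ + u₂) - u₁ - u₂ := by ring
    have := norm_sub_le ((u₀ + u₁ + u₂) - u₁) u₂
    have := norm_sub_le (u₀ + u₁ + u₂) u₁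
    rw [← e] at *
    linarith
  have p₀ := norm_nonneg u₀
  have p₁ := norm_nonneg u₁
  have p₂ := norm_nonneg u₂
  have pg := norm_nonneg (u₀ + u₁ + u₂)
  generalize ‖u₀ + u₁ + u₂‖ = g at *
  generalize ‖u₀‖ = r at *
  generalize ‖u₁‖ = s at *
  generalize ‖u₂‖ = t at *
  have hs2 := Real.sq_sqrt (show (0 : ℝ) ≤ 2 by norm_num)
  have hs0 := Real.sqrt_nonneg 2
  generalize Real.sqrt 2 = q at *
  have hq1 : 1.41 ≤ q := by nlinarith
  have hq2 : q ≤ 1.415 := by nlinarith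
  have hn0 : 0 ≤ n := by linarith
  have hS : r ^ 2 + s ^ 2 + t ^ 2 ≤ r * n := by nlinarith
  by_cases hr : r ≤ 4 / 5 * n
  · have h1 : r * n ≤ 4 / 5 * n ^ 2 := by nlinarith
    have h2 : (9 - 6 * q) * (r ^ 2 + s ^ 2 + t ^ 2) ≤ (9 - 6 * q) * (4 / 5 * n ^ 2) :=
      mul_le_mul_of_nonneg_left (hS.trans h1) (by linarith)
    have h3 : 0 ≤ (2 - q) * g ^ 2 := mul_nonneg (by linarith) (sq_nonneg _)
    nlinarith [sq_nonneg n]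
  · push Not at hr
    have hg' : 3 / 5 * n ≤ g := by linarith
    have h1 : r * n ≤ n ^ 2 := by nlinarith
    have h2 : (9 - 6 * q) * (r ^ 2 + s ^ 2 + t ^ 2) ≤ (9 - 6 * q) * n ^ 2 :=
      mul_le_mul_of_nonneg_left (hS.trans h1) (by linarith)
    have h3 : (2 - q) * (3 / 5 * n) ^ 2 ≤ (2 - q) * g ^ 2 :=
      mul_le_mul_of_nonneg_left (by gcongr) (by linarith)
    nlinarith [sq_nonneg n]

lemma sum_norm_sq_sub_norm_sum_sq_le (u : Fin 3 → ℂ) {n : ℝ} (hn : ∑ k, ‖u k‖ ≤ n) :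
    (9 - 6 * Real.sqrt 2) * ∑ k, ‖u k‖ ^ 2
      ≤ (2 - Real.sqrt 2) * ‖∑ k, u k‖ ^ 2 + (4 - 5 * Real.sqrt 2 / 2) * n ^ 2 := by
  simp only [Fin.sum_univ_three] at *
  rcases le_total ‖u 0‖ ‖u 1‖ with h01 | h01 <;> rcases le_total ‖u 1‖ ‖u 2‖ with h12 | h12 <;>
    rcases le_total ‖u 0‖ ‖u 2‖ with h02 | h02
  all_goals first
    | exact sum_norm_sq_sub_norm_sum_sq_le_of_max (by linarith) (by linarith) hn
    | have h := sum_norm_sq_sub_norm_sum_sq_le_of_max (u₀ := u 1) (u₁ := u 0) (u₂ := u 2)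
        (n := n) (by linarith) (by linarith) (by linarith)
      rw [add_comm (u 1)] at h
      linarith
    | have h := sum_norm_sq_sub_norm_sum_sq_le_of_max (u₀ := u 2) (u₁ := u 0) (u₂ := u 1)
        (n := n) (by linarith) (by linarith) (by linarith)
      rw [show u 2 + u 0 + u 1 = u 0 + u 1 + u 2 by ring] at h
      linarith

/-- Twice the expectation of `W + (b + c) / 6 • ψψᴴ` in the `m`-th column of `V`, where `W` is the
witness obtained by applying the dual of `id ⊗ Φ_{b,c}` to `ψψᴴ`. -/
def shiftedWitness (b c : ℝ) (V : Matrix (Fin 3 × Fin 3) (Fin 3 × Fin 3) ℂ)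
    (ψ : Fin 3 × Fin 3 → ℂ) (m : Fin 3 × Fin 3) : ℝ :=
  ∑ k, ∑ l, choiWeight b c k l * ‖(Vᴴ *ᵥ colTensor ψ k l) m‖ ^ 2
    - (1 - (b + c) / 3) * ‖(Vᴴ *ᵥ ψ) m‖ ^ 2

lemma conjTranspose_mulVec_eq_sum_colTensor (V : Matrix (Fin 3 × Fin 3) (Fin 3 × Fin 3) ℂ)
    (ψ : Fin 3 × Fin 3 → ℂ) (m : Fin 3 × Fin 3) :
    (Vᴴ *ᵥ ψ) m = ∑ k, (Vᴴ *ᵥ colTensor ψ k k) m := by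
  conv_lhs => rw [← sum_colTensor_diag ψ, mulVec_sum]
  simp

lemma shiftedWitness_nonneg {b c : ℝ} (hb : 0 ≤ b) (hc : 0 ≤ c) (hbc : b + c ≤ 3)
    (V : Matrix (Fin 3 × Fin 3) (Fin 3 × Fin 3) ℂ) (ψ : Fin 3 × Fin 3 → ℂ)
    (m : Fin 3 × Fin 3) : 0 ≤ shiftedWitness b c V ψ m := by
  have h := mul_le_mul_of_nonneg_left
    (norm_sq_sum_three_le fun k => (Vᴴ *ᵥ colTensor ψ k k) m) (show 0 ≤ 1 - (b + c) / 3 by linarith)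
  rw [← conjTranspose_mulVec_eq_sum_colTensor, Fin.sum_univ_three] at h
  have hA : ∀ k l, 0 ≤ b * ‖(Vᴴ *ᵥ colTensor ψ k l) m‖ ^ 2 ∧
      0 ≤ c * ‖(Vᴴ *ᵥ colTensor ψ k l) m‖ ^ 2 := fun k l => ⟨by positivity, by positivity⟩
  simp only [shiftedWitness, Fin.sum_univ_three, choiWeight, of_apply, cons_val]
  linarith [hA 0 1, hA 0 2, hA 1 0, hA 1 2, hA 2 0, hA 2 1]

section

variable {V : Matrix (Fin 3 × Fin 3) (Fin 3 × Fin 3) ℂ}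

lemma sum_shiftedWitness (hV : V ∈ Matrix.unitaryGroup (Fin 3 × Fin 3) ℂ) (b c : ℝ)
    (ψ : Fin 3 × Fin 3 → ℂ) :
    ∑ m, shiftedWitness b c V ψ m = (2 + (b + c) / 3) * ∑ p, ‖ψ p‖ ^ 2 := by
  have h : ∀ k l, ∑ m, ‖(Vᴴ *ᵥ colTensor ψ k l) m‖ ^ 2 = ∑ i, ‖ψ (i, k)‖ ^ 2 := fun k l => by
    rw [sum_norm_sq_conjTranspose_mulVec hV, sum_norm_sq_colTensor]
  simp only [shiftedWitness, Fin.sum_univ_three, Finset.sum_sub_distrib, Finset.sum_add_distrib,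
    ← Finset.mul_sum, h, sum_norm_sq_conjTranspose_mulVec hV, Fintype.sum_prod_type]
  simp only [choiWeight, of_apply, cons_val]
  ring

lemma sum_norm_sq_conjTranspose_mulVec_colTensor_le
    (hV : V ∈ Matrix.unitaryGroup (Fin 3 × Fin 3) ℂ) (ψ : Fin 3 × Fin 3 → ℂ) (m : Fin 3 × Fin 3) :
    ∑ k, ∑ l, ‖(Vᴴ *ᵥ colTensor ψ k l) m‖ ^ 2 ≤ ∑ p, ‖ψ p‖ ^ 2 := by
  calc _ ≤ ∑ k, ∑ l, (∑ i, ‖ψ (i, k)‖ ^ 2) * ∑ i, ‖V (i, l) m‖ ^ 2 :=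
        Finset.sum_le_sum fun k _ => Finset.sum_le_sum fun l _ =>
          norm_sq_conjTranspose_mulVec_colTensor_le V ψ k l m
    _ = ∑ p, ‖ψ p‖ ^ 2 := by
        simp only [← Finset.mul_sum, sum_norm_sq_col_eq_one hV, mul_one]
        rw [Fintype.sum_prod_type, Finset.sum_comm]

lemma sum_norm_conjTranspose_mulVec_colTensor_le
    (hV : V ∈ Matrix.unitaryGroup (Fin 3 × Fin 3) ℂ) (ψ : Fin 3 × Fin 3 → ℂ) (m : Fin 3 × Fin 3) :
    ∑ k, ‖(Vᴴ *ᵥ colTensor ψ k k) m‖ ≤ Real.sqrt (∑ p, ‖ψ p‖ ^ 2) := by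
  calc _ ≤ ∑ k, Real.sqrt (∑ i, ‖ψ (i, k)‖ ^ 2) * Real.sqrt (∑ i, ‖V (i, k) m‖ ^ 2) := by
        refine Finset.sum_le_sum fun k _ => ?_
        rw [← Real.sqrt_mul (by positivity)]
        exact Real.le_sqrt_of_sq_le (norm_sq_conjTranspose_mulVec_colTensor_le V ψ k k m)
    _ ≤ Real.sqrt (∑ k, ∑ i, ‖ψ (i, k)‖ ^ 2) * Real.sqrt (∑ k, ∑ i, ‖V (i, k) m‖ ^ 2) :=
        Real.sum_sqrt_mul_sqrt_le _ (fun k => by positivity) fun k => by positivity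
    _ = _ := by
        rw [sum_norm_sq_col_eq_one hV, Real.sqrt_one, mul_one, Fintype.sum_prod_type,
          Finset.sum_comm]

lemma shiftedWitness_le_of_symmetric (hV : V ∈ Matrix.unitaryGroup (Fin 3 × Fin 3) ℂ)
    (ψ : Fin 3 × Fin 3 → ℂ) (m : Fin 3 × Fin 3) :
    shiftedWitness (6 / 5) (6 / 5) V ψ m ≤ 6 / 5 * ∑ p, ‖ψ p‖ ^ 2 := by
  have h := sum_norm_sq_conjTranspose_mulVec_colTensor_le hV ψ m
  have hA : ∀ k, 0 ≤ ‖(Vᴴ *ᵥ colTensor ψ k k) m‖ ^ 2 := fun k => by positivity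
  have hB : 0 ≤ ‖(Vᴴ *ᵥ ψ) m‖ ^ 2 := by positivity
  simp only [Fin.sum_univ_three] at h
  simp only [shiftedWitness, Fin.sum_univ_three, choiWeight, of_apply, cons_val]
  linarith [hA 0, hA 1, hA 2]

lemma shiftedWitness_le_of_add_eq (hV : V ∈ Matrix.unitaryGroup (Fin 3 × Fin 3) ℂ) {b c : ℝ}
    (hb : 0 ≤ b) (hc : 0 ≤ c) (hbc : b + c = 3 * (Real.sqrt 2 - 1)) (ψ : Fin 3 × Fin 3 → ℂ)
    (m : Fin 3 × Fin 3) :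
    shiftedWitness b c V ψ m ≤ (2 + Real.sqrt 2) / 2 * ∑ p, ‖ψ p‖ ^ 2 := by
  have h := sum_norm_sq_conjTranspose_mulVec_colTensor_le hV ψ m
  have hd := sum_norm_sq_sub_norm_sum_sq_le _
    (sum_norm_conjTranspose_mulVec_colTensor_le hV ψ m)
  rw [← conjTranspose_mulVec_eq_sum_colTensor, Real.sq_sqrt (by positivity)] at hd
  have hA : ∀ k l, b * ‖(Vᴴ *ᵥ colTensor ψ k l) m‖ ^ 2
        ≤ 3 * (Real.sqrt 2 - 1) * ‖(Vᴴ *ᵥ colTensor ψ k l) m‖ ^ 2 ∧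
      c * ‖(Vᴴ *ᵥ colTensor ψ k l) m‖ ^ 2
        ≤ 3 * (Real.sqrt 2 - 1) * ‖(Vᴴ *ᵥ colTensor ψ k l) m‖ ^ 2 := fun k l =>
    ⟨by gcongr; linarith, by gcongr; linarith⟩
  have h' := mul_le_mul_of_nonneg_left h (show 0 ≤ 3 * (Real.sqrt 2 - 1) by linarith)
  have e1 : 3 - b - c = 3 - 3 * (Real.sqrt 2 - 1) := by linarith
  have e2 : (b + c) / 3 = Real.sqrt 2 - 1 := by linarith
  simp only [Fin.sum_univ_three] at h' hd
  simp only [shiftedWitness, Fin.sum_univ_three, choiWeight, of_apply, cons_val, e1, e2]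
  linarith [hA 0 1, hA 0 2, hA 1 0, hA 1 2, hA 2 0, hA 2 1]

end

/-- Twice the quadratic form of `(id ⊗ Φ_{b,c})(V diag(d) Vᴴ)` at `ψ`. -/
def choiForm (b c : ℝ) (V : Matrix (Fin 3 × Fin 3) (Fin 3 × Fin 3) ℂ) (d : Fin 3 × Fin 3 → ℝ)
    (ψ : Fin 3 × Fin 3 → ℂ) : ℝ :=
  ∑ k, ∑ l, choiWeight b c k l * ∑ m, d m * ‖(Vᴴ *ᵥ colTensor ψ k l) m‖ ^ 2
    - ∑ m, d m * ‖(Vᴴ *ᵥ ψ) m‖ ^ 2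

lemma dotProduct_idTensor_PhiG_eq_choiForm (b c : ℝ)
    (V : Matrix (Fin 3 × Fin 3) (Fin 3 × Fin 3) ℂ) (d : Fin 3 × Fin 3 → ℝ)
    (ψ : Fin 3 × Fin 3 → ℂ) :
    star ψ ⬝ᵥ idTensor (PhiG b c) (V * diagonal (fun i => (d i : ℂ)) * Vᴴ) *ᵥ ψ
      = ((1 / 2 * choiForm b c V d ψ : ℝ) : ℂ) := by
  simp only [dotProduct_idTensor_PhiG, dotProduct_diagonalization, choiForm]
  push_cast
  ring

lemma choiForm_eq_sum_shiftedWitness (b c : ℝ) (V : Matrix (Fin 3 × Fin 3) (Fin 3 × Fin 3) ℂ)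
    (d : Fin 3 × Fin 3 → ℝ) (ψ : Fin 3 × Fin 3 → ℂ) :
    choiForm b c V d ψ = ∑ m, d m * shiftedWitness b c V ψ m
      - (b + c) / 3 * ∑ m, d m * ‖(Vᴴ *ᵥ ψ) m‖ ^ 2 := by
  simp only [choiForm, shiftedWitness, mul_sub, Finset.sum_sub_distrib, Finset.mul_sum]
  rw [Finset.sum_comm (s := Finset.univ (α := Fin 3 × Fin 3))]
  simp only [Finset.sum_comm (s := Finset.univ (α := Fin 3 × Fin 3))
    (t := Finset.univ (α := Fin 3)), mul_left_comm (d _), sub_mul, one_mul, mul_sub, Finset.sum_sub_distrib]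
  ring

/-- `choiForm` is affine in `(b, c)`. -/
lemma choiForm_convexCombination {b c t₁ t₂ t₃ t₄ r q : ℝ} (htsum : t₁ + t₂ + t₃ + t₄ = 1)
    (hb : b = t₃ * q + t₄ * r) (hc : c = t₂ * r + t₃ * q)
    (V : Matrix (Fin 3 × Fin 3) (Fin 3 × Fin 3) ℂ)
    (d : Fin 3 × Fin 3 → ℝ) (ψ : Fin 3 × Fin 3 → ℂ) :
    choiForm b c V d ψ = t₁ * choiForm 0 0 V d ψ + t₂ * choiForm 0 r V d ψ
      + t₃ * choiForm q q V d ψ + t₄ * choiForm r 0 V d ψ := by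
  obtain rfl : t₁ = 1 - t₂ - t₃ - t₄ := by linarith
  simp only [choiForm, Fin.sum_univ_three, choiWeight, of_apply, cons_val, hb, hc]
  ring

section

variable {V : Matrix (Fin 3 × Fin 3) (Fin 3 × Fin 3) ℂ} {d : Fin 3 × Fin 3 → ℝ}

lemma sum_shiftedWitness_sub_le_choiForm (hV : V ∈ Matrix.unitaryGroup (Fin 3 × Fin 3) ℂ)
    {b c : ℝ} (hbc : 0 ≤ b + c) (hmax : ∀ i, d i ≤ d (1, 0)) (ψ : Fin 3 × Fin 3 → ℂ) :
    ∑ m, d m * shiftedWitness b c V ψ m - (b + c) / 3 * (d (1, 0) * ∑ p, ‖ψ p‖ ^ 2)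
      ≤ choiForm b c V d ψ := by
  rw [choiForm_eq_sum_shiftedWitness, ← sum_norm_sq_conjTranspose_mulVec hV, Finset.mul_sum]
  gcongr
  exact hmax _

lemma choiForm_zero_zero_nonneg (hd : ∀ i, 0 ≤ d i) (ψ : Fin 3 × Fin 3 → ℂ) :
    0 ≤ choiForm 0 0 V d ψ := by
  rw [choiForm_eq_sum_shiftedWitness]
  simpa using Finset.sum_nonneg fun m _ => mul_nonneg (hd m)
    (shiftedWitness_nonneg le_rfl le_rfl (by norm_num) V ψ m)

lemma choiForm_symmetric_nonneg (hV : V ∈ Matrix.unitaryGroup (Fin 3 × Fin 3) ℂ)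
    (h01 : d (0, 0) ≤ d (0, 1)) (h12 : d (0, 1) ≤ d (1, 1))
    (h2 : ∀ i, i ≠ (0, 0) → i ≠ (0, 1) → d (1, 1) ≤ d i) (hmax : ∀ i, d i ≤ d (1, 0))
    (hppt : ∀ s t : ℝ,
      0 ≤ s ^ 2 * d (0, 0) + s * t * d (0, 1) + t ^ 2 * d (1, 1) - s * t * d (1, 0))
    (ψ : Fin 3 × Fin 3 → ℂ) : 0 ≤ choiForm (6 / 5) (6 / 5) V d ψ := by
  have hlow := sum_mul_ge_of_le_off {(0, 0), (0, 1)} (d := d) (τ := d (1, 1))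
    (shiftedWitness_nonneg (b := 6 / 5) (c := 6 / 5) (by norm_num) (by norm_num) (by norm_num) V ψ)
    fun m hm => by
      simp only [Finset.mem_insert, Finset.mem_singleton, not_or] at hm
      exact h2 m hm.1 hm.2
  rw [sum_shiftedWitness hV, Finset.sum_pair (by decide)] at hlow
  have hform := sum_shiftedWitness_sub_le_choiForm hV (b := 6 / 5) (c := 6 / 5) (by norm_num) hmax ψ
  have q0 := mul_le_mul_of_nonneg_left (shiftedWitness_le_of_symmetric hV ψ (0, 0))
    (sub_nonneg.2 (h01.trans h12))
  have q1 := mul_le_mul_of_nonneg_left (shiftedWitness_le_of_symmetric hV ψ (0, 1))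
    (sub_nonneg.2 h12)
  have hN : 0 ≤ ∑ p, ‖ψ p‖ ^ 2 := by positivity
  have hp := mul_nonneg (hppt 2 1) hN
  have hs := mul_nonneg (sub_nonneg.2 h01) hN
  linarith

lemma choiForm_nonneg_of_add_eq (hV : V ∈ Matrix.unitaryGroup (Fin 3 × Fin 3) ℂ)
    {b c : ℝ} (hb : 0 ≤ b) (hc : 0 ≤ c) (hbc : b + c = 3 * (Real.sqrt 2 - 1))
    (h01 : d (0, 0) ≤ d (0, 1)) (h12 : d (0, 1) ≤ d (1, 1))
    (h2 : ∀ i, i ≠ (0, 0) → i ≠ (0, 1) → d (1, 1) ≤ d i) (hmax : ∀ i, d i ≤ d (1, 0))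
    (hppt : ∀ s t : ℝ,
      0 ≤ s ^ 2 * d (0, 0) + s * t * d (0, 1) + t ^ 2 * d (1, 1) - s * t * d (1, 0))
    (ψ : Fin 3 × Fin 3 → ℂ) : 0 ≤ choiForm b c V d ψ := by
  have hq := Real.sq_sqrt (show (0 : ℝ) ≤ 2 by norm_num)
  have hq0 := Real.sqrt_nonneg 2
  have hq2 : Real.sqrt 2 ≤ 2 := by nlinarith
  have hlow := sum_mul_ge_of_le_off {(0, 0)} (d := d) (τ := d (0, 1))
    (shiftedWitness_nonneg hb hc (by linarith) V ψ)
    fun m hm => by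
      rw [Finset.mem_singleton] at hm
      by_cases h : m = (0, 1)
      · rw [h]
      · exact h12.trans (h2 m hm h)
  rw [sum_shiftedWitness hV, Finset.sum_singleton] at hlow
  have hform := sum_shiftedWitness_sub_le_choiForm hV (add_nonneg hb hc) hmax ψ
  have q0 := mul_le_mul_of_nonneg_left (shiftedWitness_le_of_add_eq hV hb hc hbc ψ (0, 0))
    (sub_nonneg.2 h01)
  have hN : 0 ≤ ∑ p, ‖ψ p‖ ^ 2 := by positivity
  have e : (b + c) / 3 = Real.sqrt 2 - 1 := by linarith
  rw [e] at hlow hform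
  have hp : 0 ≤ (2 + Real.sqrt 2) / 2 * d (0, 0) + Real.sqrt 2 / 2 * d (0, 1)
      - (Real.sqrt 2 - 1) * d (1, 0) := by
    have h := mul_nonneg (show 0 ≤ (2 - Real.sqrt 2) / 2 by linarith) (hppt (1 + Real.sqrt 2) 1)
    have h' := mul_nonneg (show 0 ≤ (2 - Real.sqrt 2) / 2 by linarith)
      (sub_nonneg.2 (hmax (1, 1)))
    linear_combination h + h' - (Real.sqrt 2 / 2 * d (0, 0) + d (0, 1) / 2 - d (1, 0) / 2) * hq
  have hp' := mul_nonneg hp hN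
  linarith

end

/-- If `(b, c)` lies in the convex hull of `(0,0)`, `(0, 3(√2-1))`, `(6/5, 6/5)` and
`(3(√2-1), 0)`, then the generalized Choi map `Φ_{b,c}` cannot detect entanglement in any
absolutely PPT state on `ℂ³ ⊗ ℂ³`. -/
theorem gen_choi_map_of_absPPT (b c : ℝ) (hb : 0 ≤ b) (hc : 0 ≤ c)
    (t₁ t₂ t₃ t₄ : ℝ) (ht₁ : 0 ≤ t₁) (ht₂ : 0 ≤ t₂) (ht₃ : 0 ≤ t₃) (ht₄ : 0 ≤ t₄)
    (htsum : t₁ + t₂ + t₃ + t₄ = 1)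
    (hbdef : b = t₃ * (6 / 5) + t₄ * (3 * (Real.sqrt 2 - 1)))
    (hcdef : c = t₂ * (3 * (Real.sqrt 2 - 1)) + t₃ * (6 / 5))
    (ρ : Matrix (Fin 3 × Fin 3) (Fin 3 × Fin 3) ℂ)
    (hρ : ρ.PosSemidef) (htr : ρ.trace = 1) (hppt : AbsolutelyPPT ρ) :
    (idTensor (PhiG b c) ρ).PosSemidef := by
  obtain ⟨V, hV, d, hd, hd0, h01, h12, h2, hmax⟩ := exists_sorted_diagonalization hρ
  have hev := hppt.eigenvalue_inequality hV hd
  have hr : 0 ≤ 3 * (Real.sqrt 2 - 1) := by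
    have := Real.one_lt_sqrt_two
    linarith
  refine PosSemidef.of_dotProduct_mulVec_nonneg (isHermitian_idTensor_PhiG b c hρ.1) fun ψ => ?_
  rw [hd, dotProduct_idTensor_PhiG_eq_choiForm, Complex.zero_le_real,
    choiForm_convexCombination htsum hbdef hcdef]
  have f₁ := choiForm_zero_zero_nonneg (V := V) hd0 ψ
  have f₂ := choiForm_nonneg_of_add_eq hV le_rfl hr (zero_add _) h01 h12 h2 hmax hev ψ
  have f₃ := choiForm_symmetric_nonneg hV h01 h12 h2 hmax hev ψ
  have f₄ := choiForm_nonneg_of_add_eq hV hr le_rfl (add_zero _) h01 h12 h2 hmax hev ψ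
  positivity

end
end

section
/- Let n ≥ 4 be even and let v ∈ ℂ^n ⊗ ℂ^n be a unit vector. Then every eigenvalue of the Hermitian matrix (id_n ⊗ Φ_BH)(v v†) lies in the interval [−1/n, 1/(n−2)], where Φ_BH is the Breuer–Hall map (which is self-dual for the chosen antisymmetric unitary V, so Φ_BH† = Φ_BH). -/
open Matrix BigOperators
open scoped ComplexOrder

noncomputable section

/-- The antisymmetric unitary `V` used in the Breuer–Hall map: in 0-indexed form,
`V i j = 1` if `j = n - 1 - i` and `i < n/2`, `V i j = -1` if `j = n - 1 - i` and
`i ≥ n/2`, and `V i j = 0` otherwise. -/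
def BHV (n : ℕ) : Matrix (Fin n) (Fin n) ℂ :=
  Matrix.of fun i j =>
    if (j : ℕ) = n - 1 - (i : ℕ) then (if (i : ℕ) < n / 2 then 1 else -1) else 0

/-- The Breuer–Hall map `Φ_BH : M_n(ℂ) → M_n(ℂ)`. -/
def PhiBH (n : ℕ) (X : Matrix (Fin n) (Fin n) ℂ) : Matrix (Fin n) (Fin n) ℂ :=
  ((1 : ℂ) / ((n : ℂ) - 2)) •
    (Matrix.trace X • (1 : Matrix (Fin n) (Fin n) ℂ) - X - BHV n * Xᵀ * (BHV n)ᴴ)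

open scoped Matrix.Norms.Frobenius

lemma Matrix.trace_mul_conjTranspose_self_eq_frobenius {m n : Type*} [Fintype m] [Fintype n]
    (A : Matrix m n ℂ) : (A * Aᴴ).trace = ((‖A‖ ^ 2 : ℝ) : ℂ) := by
  have h : ‖A‖ ^ 2 = ∑ i, ∑ j, ‖A i j‖ ^ 2 := by
    rw [Matrix.frobenius_norm_def, ← Real.sqrt_eq_rpow, Real.sq_sqrt (by positivity)]
    simp
  rw [h]
  simp [Matrix.trace, Matrix.mul_apply, Complex.mul_conj, Complex.normSq_eq_norm_sq]

lemma Matrix.norm_trace_conjTranspose_mul_le {m n : Type*} [Fintype m] [Fintype n]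
    (A B : Matrix m n ℂ) : ‖(Aᴴ * B).trace‖ ≤ ‖A‖ * ‖B‖ := by
  have h (A : Matrix m n ℂ) : ‖A‖ = √(∑ p : m × n, ‖A p.1 p.2‖ ^ 2) := by
    rw [Matrix.frobenius_norm_def, ← Real.sqrt_eq_rpow, Fintype.sum_prod_type]
    simp
  have e : (Aᴴ * B).trace = ∑ p : m × n, star (A p.1 p.2) * B p.1 p.2 := by
    rw [Fintype.sum_prod_type, Finset.sum_comm]
    simp [Matrix.trace, Matrix.mul_apply]
  rw [e, h, h]
  refine (norm_sum_le _ _).trans ?_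
  simpa using Real.sum_mul_le_sqrt_mul_sqrt Finset.univ
    (fun p : m × n => ‖A p.1 p.2‖) (fun p => ‖B p.1 p.2‖)

lemma Matrix.sq_norm_vecMulVec_sub_transpose_le {n : Type*} [Fintype n] (x y : n → ℂ) :
    ‖vecMulVec x y - vecMulVec y x‖ ^ 2 ≤ 2 * ((∑ k, ‖x k‖ ^ 2) * ∑ k, ‖y k‖ ^ 2) := by
  have key : ((‖vecMulVec x y - vecMulVec y x‖ ^ 2 : ℝ) : ℂ) =
      ((2 * ((∑ k, ‖x k‖ ^ 2) * ∑ k, ‖y k‖ ^ 2) - 2 * ‖star x ⬝ᵥ y‖ ^ 2 : ℝ) : ℂ) := by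
    have hs (z : n → ℂ) : ((∑ k, ‖z k‖ ^ 2 : ℝ) : ℂ) = z ⬝ᵥ star z := by
      simp [dotProduct, Complex.mul_conj, Complex.normSq_eq_norm_sq]
    have hc : ((‖star x ⬝ᵥ y‖ ^ 2 : ℝ) : ℂ) = (y ⬝ᵥ star x) * (x ⬝ᵥ star y) := by
      rw [← Complex.normSq_eq_norm_sq, ← Complex.mul_conj, dotProduct_comm (star x)]
      congr 1
      simp [dotProduct, mul_comm]
    rw [← Matrix.trace_mul_conjTranspose_self_eq_frobenius, Complex.ofReal_sub,
      Complex.ofReal_mul, Complex.ofReal_mul, Complex.ofReal_mul, hc, hs, hs]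
    simp only [conjTranspose_sub, conjTranspose_vecMulVec, sub_mul, mul_sub,
      vecMulVec_mul_vecMulVec, vecMulVec_smul, trace_sub, trace_smul,
      trace_vecMulVec, smul_eq_mul]
    push_cast
    ring
  have := Complex.ofReal_injective key
  nlinarith [sq_nonneg ‖star x ⬝ᵥ y‖]

lemma Matrix.sq_norm_transpose_mul_sub_transpose_le {m n : Type*} [Fintype m] [Fintype n]
    (X Y : Matrix m n ℂ) : ‖Xᵀ * Y - Yᵀ * X‖ ^ 2 ≤ 2 * (‖X‖ ^ 2 * ‖Y‖ ^ 2) := by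
  have h (A : Matrix m n ℂ) : ‖A‖ ^ 2 = ∑ i, ∑ j, ‖A i j‖ ^ 2 := by
    rw [Matrix.frobenius_norm_def, ← Real.sqrt_eq_rpow, Real.sq_sqrt (by positivity)]
    simp
  have e : Xᵀ * Y - Yᵀ * X = ∑ j, (vecMulVec (X j) (Y j) - vecMulVec (Y j) (X j)) := by
    ext k l
    simp [Matrix.mul_apply, Matrix.sum_apply, vecMulVec_apply]
  have hle : ‖Xᵀ * Y - Yᵀ * X‖ ≤
      √2 * ∑ j, √(∑ k, ‖X j k‖ ^ 2) * √(∑ k, ‖Y j k‖ ^ 2) := by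
    rw [e, Finset.mul_sum]
    refine norm_sum_le_of_le _ fun j _ => ?_
    rw [← Real.sqrt_mul (by positivity), ← Real.sqrt_mul (by positivity)]
    exact Real.le_sqrt_of_sq_le (Matrix.sq_norm_vecMulVec_sub_transpose_le _ _)
  have hcs := Finset.sum_mul_sq_le_sq_mul_sq Finset.univ
    (fun j => √(∑ k, ‖X j k‖ ^ 2)) (fun j => √(∑ k, ‖Y j k‖ ^ 2))
  calc ‖Xᵀ * Y - Yᵀ * X‖ ^ 2
      ≤ (√2 * ∑ j, √(∑ k, ‖X j k‖ ^ 2) * √(∑ k, ‖Y j k‖ ^ 2)) ^ 2 := by gcongr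
    _ ≤ 2 * (‖X‖ ^ 2 * ‖Y‖ ^ 2) := by
      rw [mul_pow, Real.sq_sqrt (by norm_num), h, h]
      refine mul_le_mul_of_nonneg_left (hcs.trans_eq ?_) (by norm_num)
      congr 1 <;> exact Finset.sum_congr rfl fun j _ => Real.sq_sqrt (by positivity)

lemma BHV_transpose {n : ℕ} (hne : Even n) : (BHV n)ᵀ = -BHV n := by
  obtain ⟨m, rfl⟩ := hne
  ext i j
  rw [Matrix.neg_apply]
  simp only [BHV, transpose_apply, of_apply]
  have := i.2
  have := j.2
  split_ifs <;> first | omega | simp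

lemma BHV_map_star (n : ℕ) : (BHV n).map star = BHV n := by
  ext i j
  simp only [BHV, map_apply, of_apply]
  split_ifs <;> simp

lemma BHV_conjTranspose {n : ℕ} (hne : Even n) : (BHV n)ᴴ = -BHV n := by
  rw [conjTranspose, BHV_transpose hne, Matrix.map_neg _ (by simp), BHV_map_star]

lemma BHV_mul_conjTranspose (n : ℕ) : BHV n * (BHV n)ᴴ = 1 := by
  ext i j
  rw [mul_apply, Finset.sum_eq_single (Fin.rev i)]
  · have := i.2
    have := j.2
    simp only [BHV, conjTranspose_apply, of_apply, Fin.val_rev, one_apply, Fin.ext_iff]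
    split_ifs <;> first | omega | simp
  · intro b _ hb
    have : ¬ ((b : ℕ) = n - 1 - (i : ℕ)) := by
      intro h
      apply hb
      ext
      rw [Fin.val_rev]
      omega
    simp [BHV, this]
  · simp

lemma idTensor_PhiBH_vecMulVec_apply {n : ℕ} (A : Matrix (Fin n) (Fin n) ℂ) (i k j l : Fin n) :
    idTensor (PhiBH n) (vecMulVec (fun p => A p.1 p.2) (star fun p => A p.1 p.2)) (i, k) (j, l) =
      1 / ((n : ℂ) - 2) * ((A * Aᴴ) i j * (1 : Matrix (Fin n) (Fin n) ℂ) k l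
        - A i k * star (A j l) - (BHV n * Aᴴ) k j * (A * (BHV n)ᴴ) i l) := by
  have h1 : (of fun a b => vecMulVec (fun p : Fin n × Fin n => A p.1 p.2)
      (star fun p => A p.1 p.2) (i, a) (j, b)) = vecMulVec (A i) (star (A j)) := by
    ext a b
    simp [vecMulVec_apply]
  have h2 : BHV n * vecMulVec (star (A j)) (A i) * (BHV n)ᴴ =
      vecMulVec (BHV n *ᵥ star (A j)) (A i ᵥ* (BHV n)ᴴ) := by
    rw [mul_vecMulVec, vecMulVec_mul]
  rw [idTensor, of_apply, h1, PhiBH, transpose_vecMulVec, h2, Matrix.smul_apply, Matrix.sub_apply,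
    Matrix.sub_apply, Matrix.smul_apply, trace_vecMulVec]
  rfl

lemma dotProduct_idTensor_PhiBH_mulVec {n : ℕ} (A W : Matrix (Fin n) (Fin n) ℂ) :
    (star fun p : Fin n × Fin n => W p.1 p.2) ⬝ᵥ
      (idTensor (PhiBH n) (vecMulVec (fun p => A p.1 p.2) (star fun p => A p.1 p.2)) *ᵥ
        fun p => W p.1 p.2) =
      1 / ((n : ℂ) - 2) * (((BHV n * Aᴴ * W) * (BHV n * Aᴴ * W)ᴴ).trace
        - (Aᴴ * W).trace * star (Aᴴ * W).trace
        - ((BHV n * Aᴴ * W) * (BHV n * Aᴴ * W).map star).trace) := by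
  have h1 : ((BHV n * Aᴴ * W) * (BHV n * Aᴴ * W)ᴴ).trace = (Wᴴ * (A * Aᴴ) * W).trace := by
    have hV : (BHV n)ᴴ * BHV n = 1 := mul_eq_one_comm.mp (BHV_mul_conjTranspose n)
    rw [trace_mul_comm, Matrix.mul_assoc (BHV n), conjTranspose_mul, Matrix.mul_assoc,
      ← Matrix.mul_assoc _ (BHV n), hV, Matrix.one_mul]
    simp only [conjTranspose_mul, conjTranspose_conjTranspose, Matrix.mul_assoc]
  have h2 : star (Aᴴ * W).trace = (Wᴴ * A).trace := by
    rw [← trace_conjTranspose, conjTranspose_mul, conjTranspose_conjTranspose]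
  have h3 : (BHV n * Aᴴ * W).map star = ((A * (BHV n)ᴴ)ᵀ * W.map star) := by
    have : (BHV n * Aᴴ * W).map star = ((BHV n * Aᴴ * W)ᴴ)ᵀ := rfl
    rw [this, conjTranspose_mul, conjTranspose_mul, conjTranspose_conjTranspose, transpose_mul]
    rfl
  rw [h1, h2, h3]
  have e1 : (Wᴴ * (A * Aᴴ) * W).trace = ∑ i, ∑ k, ∑ j, ∑ l,
      star (W i k) * ((A * Aᴴ) i j * (1 : Matrix (Fin n) (Fin n) ℂ) k l) * W j l := by
    rw [Matrix.mul_assoc, trace, Finset.sum_comm]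
    refine Finset.sum_congr rfl fun k _ => ?_
    rw [diag_apply, mul_apply]
    refine Finset.sum_congr rfl fun i _ => ?_
    rw [mul_apply, conjTranspose_apply, Finset.mul_sum]
    refine Finset.sum_congr rfl fun j _ => ?_
    simp [one_apply, mul_assoc]
  have e2 : (Aᴴ * W).trace * (Wᴴ * A).trace = ∑ i, ∑ k, ∑ j, ∑ l,
      star (W i k) * (A i k * star (A j l)) * W j l := by
    have hAW (A W : Matrix (Fin n) (Fin n) ℂ) :
        (Aᴴ * W).trace = ∑ j, ∑ l, star (A j l) * W j l := by
      rw [trace, Finset.sum_comm]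
      simp only [diag_apply, mul_apply, conjTranspose_apply]
    rw [hAW, hAW, mul_comm]
    simp only [Finset.sum_mul]
    simp only [Finset.mul_sum, mul_assoc]
  have e3 : ((BHV n * Aᴴ * W) * ((A * (BHV n)ᴴ)ᵀ * W.map star)).trace = ∑ i, ∑ k, ∑ j, ∑ l,
      star (W i k) * ((BHV n * Aᴴ) k j * (A * (BHV n)ᴴ) i l) * W j l := by
    rw [trace, Finset.sum_comm]
    refine Finset.sum_congr rfl fun k _ => ?_
    rw [diag_apply, mul_apply]
    simp only [mul_apply (M := BHV n * Aᴴ), mul_apply (M := (A * (BHV n)ᴴ)ᵀ),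
      Finset.sum_mul_sum]
    rw [Finset.sum_comm_cycle]
    refine Finset.sum_congr rfl fun i _ => ?_
    rw [Finset.sum_comm]
    refine Finset.sum_congr rfl fun j _ => Finset.sum_congr rfl fun l _ => ?_
    rw [transpose_apply, map_apply]
    ring
  rw [e1, e2, e3]
  simp only [dotProduct, mulVec, Fintype.sum_prod_type, idTensor_PhiBH_vecMulVec_apply,
    Pi.star_apply, Finset.mul_sum, ← Finset.sum_sub_distrib]
  refine Finset.sum_congr rfl fun i _ => Finset.sum_congr rfl fun k _ =>
    Finset.sum_congr rfl fun j _ => Finset.sum_congr rfl fun l _ => ?_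
  ring

/-- The norm of twice the antisymmetric part of a matrix. -/
lemma Matrix.sq_norm_sub_transpose_eq {n : Type*} [Fintype n] (G : Matrix n n ℂ) :
    ((‖G - Gᵀ‖ ^ 2 : ℝ) : ℂ) = 2 * ((G * Gᴴ).trace - (G * G.map star).trace) := by
  have h : G.map star = (Gᴴ)ᵀ := rfl
  have h1 : (Gᵀ * Gᴴᵀ).trace = (G * Gᴴ).trace := by
    rw [← transpose_mul, trace_transpose, trace_mul_comm]
  have h2 : (Gᵀ * Gᴴ).trace = (G * Gᴴᵀ).trace := by
    rw [← trace_transpose, transpose_mul, transpose_transpose, trace_mul_comm]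
  rw [← trace_mul_conjTranspose_self_eq_frobenius, h, conjTranspose_sub,
    show Gᵀᴴ = Gᴴᵀ from rfl]
  simp only [sub_mul, mul_sub, trace_sub, h1, h2]
  ring

lemma frobenius_norm_sq_BHV (n : ℕ) : ‖BHV n‖ ^ 2 = n := by
  have h := trace_mul_conjTranspose_self_eq_frobenius (BHV n)
  rw [BHV_mul_conjTranspose, trace_one, Fintype.card_fin] at h
  exact_mod_cast h.symm

lemma four_mul_sq_norm_trace_le {n : ℕ} (hne : Even n) (B : Matrix (Fin n) (Fin n) ℂ) :
    4 * ‖B.trace‖ ^ 2 ≤ n * ‖BHV n * B - (BHV n * B)ᵀ‖ ^ 2 := by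
  have hV : (BHV n)ᴴ * BHV n = 1 := mul_eq_one_comm.mp (BHV_mul_conjTranspose n)
  have h1 : ((BHV n)ᴴ * (BHV n * B)).trace = B.trace := by
    rw [← Matrix.mul_assoc, hV, Matrix.one_mul]
  have h2 : ((BHV n)ᴴ * (BHV n * B)ᵀ).trace = -B.trace := by
    rw [← h1, ← trace_transpose, transpose_mul, transpose_transpose, trace_mul_comm,
      BHV_conjTranspose hne, transpose_neg, BHV_transpose hne, neg_neg, Matrix.neg_mul, trace_neg,
      neg_neg]
  have h3 : ((BHV n)ᴴ * (BHV n * B - (BHV n * B)ᵀ)).trace = 2 * B.trace := by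
    rw [Matrix.mul_sub, trace_sub, h1, h2]
    ring
  have h4 := norm_trace_conjTranspose_mul_le (BHV n) (BHV n * B - (BHV n * B)ᵀ)
  rw [h3, norm_mul, Complex.norm_ofNat] at h4
  calc 4 * ‖B.trace‖ ^ 2 = (2 * ‖B.trace‖) ^ 2 := by ring
    _ ≤ (‖BHV n‖ * ‖BHV n * B - (BHV n * B)ᵀ‖) ^ 2 := by gcongr
    _ = _ := by rw [mul_pow, frobenius_norm_sq_BHV]

lemma sq_norm_BHV_mul_sub_transpose_le {n : ℕ} (A W : Matrix (Fin n) (Fin n) ℂ) :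
    ‖BHV n * (Aᴴ * W) - (BHV n * (Aᴴ * W))ᵀ‖ ^ 2 ≤ 2 * (‖A‖ ^ 2 * ‖W‖ ^ 2) := by
  have hV : (BHV n)ᴴ * BHV n = 1 := mul_eq_one_comm.mp (BHV_mul_conjTranspose n)
  have hA : ‖(BHV n * Aᴴ)ᵀ‖ ^ 2 = ‖A‖ ^ 2 := by
    rw [frobenius_norm_transpose]
    apply Complex.ofReal_injective
    rw [← trace_mul_conjTranspose_self_eq_frobenius, ← trace_mul_conjTranspose_self_eq_frobenius,
      trace_mul_comm, conjTranspose_mul, conjTranspose_conjTranspose, Matrix.mul_assoc,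
      ← Matrix.mul_assoc _ (BHV n), hV, Matrix.one_mul]
  have h := sq_norm_transpose_mul_sub_transpose_le (BHV n * Aᴴ)ᵀ W
  rwa [hA, transpose_transpose, ← transpose_mul, Matrix.mul_assoc] at h

lemma sq_norm_eq_one_of_sum_star_mul {m n : Type*} [Fintype m] [Fintype n] (A : Matrix m n ℂ)
    (h : ∑ p : m × n, star (A p.1 p.2) * A p.1 p.2 = 1) : ‖A‖ ^ 2 = 1 := by
  apply Complex.ofReal_injective
  rw [← trace_mul_conjTranspose_self_eq_frobenius, Complex.ofReal_one, ← h,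
    Fintype.sum_prod_type]
  simp [trace, mul_apply, mul_comm]

/-- For even `n ≥ 4` and a unit vector `v ∈ ℂⁿ ⊗ ℂⁿ`, the eigenvalues of
`(id_n ⊗ Φ_BH)(v v†)` lie in `[-1/n, 1/(n-2)]`. -/
theorem eigenvalues_idTensor_PhiBH_mem_Icc {n : ℕ} (hn : 4 ≤ n) (hne : Even n)
    (v : Fin n × Fin n → ℂ) (hv : (∑ p, star (v p) * v p) = (1 : ℂ))
    (h : (idTensor (PhiBH n) (Matrix.vecMulVec v (star v))).IsHermitian) :
    ∀ i, h.eigenvalues i ∈ Set.Icc (-(1 / (n : ℝ))) (1 / ((n : ℝ) - 2)) := by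
  intro i
  set A : Matrix (Fin n) (Fin n) ℂ := of fun i k => v (i, k)
  set u := h.eigenvectorBasis i with hu
  set W : Matrix (Fin n) (Fin n) ℂ := of fun i k => u (i, k)
  have hA : ‖A‖ ^ 2 = 1 := sq_norm_eq_one_of_sum_star_mul A hv
  have hW : ‖W‖ ^ 2 = 1 := by
    apply sq_norm_eq_one_of_sum_star_mul
    have h1 : inner ℂ u u = (1 : ℂ) := by
      rw [inner_self_eq_norm_sq_to_K, hu, h.eigenvectorBasis.orthonormal.1 i]
      simp
    rw [← h1, PiLp.inner_apply]
    simp only [W, of_apply, RCLike.inner_apply, RCLike.star_def, mul_comm]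
  set G := BHV n * (Aᴴ * W) with hG
  have key : h.eigenvalues i =
      1 / ((n : ℝ) - 2) * (‖G - Gᵀ‖ ^ 2 / 2 - ‖(Aᴴ * W).trace‖ ^ 2) := by
    apply Complex.ofReal_injective
    have hq := dotProduct_idTensor_PhiBH_mulVec A W
    have hs := sq_norm_sub_transpose_eq G
    have ht : (Aᴴ * W).trace * star (Aᴴ * W).trace = ((‖(Aᴴ * W).trace‖ ^ 2 : ℝ) : ℂ) := by
      rw [← Complex.normSq_eq_norm_sq, ← Complex.mul_conj]
      rfl
    have hval : 1 / ((n : ℂ) - 2) * ((G * Gᴴ).trace - (Aᴴ * W).trace * star (Aᴴ * W).trace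
        - (G * G.map star).trace) =
        ((1 / ((n : ℝ) - 2) * (‖G - Gᵀ‖ ^ 2 / 2 - ‖(Aᴴ * W).trace‖ ^ 2) : ℝ) : ℂ) := by
      rw [ht]
      push_cast at hs ⊢
      rw [hs]
      ring
    rw [Matrix.mul_assoc (BHV n) Aᴴ W, ← hG, hval] at hq
    rw [h.eigenvalues_eq]
    exact congrArg (fun z : ℂ => ((z.re : ℝ) : ℂ)) hq
  have hlow := four_mul_sq_norm_trace_le hne (Aᴴ * W)
  have hup := sq_norm_BHV_mul_sub_transpose_le A W
  have htr := norm_trace_conjTranspose_mul_le A W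
  rw [← hG] at hlow hup
  rw [hA, hW] at hup
  have htr2 : ‖(Aᴴ * W).trace‖ ^ 2 ≤ 1 := by
    calc ‖(Aᴴ * W).trace‖ ^ 2 ≤ (‖A‖ * ‖W‖) ^ 2 := by gcongr
      _ = 1 := by rw [mul_pow, hA, hW, one_mul]
  have hn' : (4 : ℝ) ≤ n := by exact_mod_cast hn
  have hn2 : (0 : ℝ) < (n : ℝ) - 2 := by linarith
  rw [key, one_div_mul_eq_div, Set.mem_Icc]
  constructor
  · rw [← neg_div, div_le_div_iff₀ (by linarith) hn2]
    nlinarith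
  · rw [div_le_div_iff_of_pos_right hn2]
    nlinarith [sq_nonneg ‖(Aᴴ * W).trace‖]

end
end

section
/- Let n ≥ 4 be even and let ρ be an absolutely PPT density matrix on ℂ^n ⊗ ℂ^n. Then (id_n ⊗ Φ_BH)(ρ) is positive semidefinite, where Φ_BH is the Breuer–Hall map. That is, the Breuer–Hall map cannot detect entanglement in any absolutely PPT state. -/
open Matrix BigOperators
open scoped ComplexOrder

noncomputable section

/-- A weighted sum is nonnegative when the weights are at most `t`, sum to at least `2 * t`, have
total negative part at most `t`, and every value is at most the sum of any three others. -/
theorem sum_mul_nonneg_of_le_add_three {ι : Type*} [Fintype ι] [DecidableEq ι] (μ r : ι → ℝ)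
    (t : ℝ) (hr : ∀ k, 0 ≤ r k) (hμ : ∀ k, μ k ≤ t) (hsum : 2 * t ≤ ∑ k, μ k)
    (hneg : ∑ k with μ k < 0, -μ k ≤ t)
    (hr3 : ∀ a b c d, a ≠ b → a ≠ c → a ≠ d → b ≠ c → b ≠ d → c ≠ d → r d ≤ r a + r b + r c) :
    0 ≤ ∑ k, μ k * r k := by
  classical
  set N : Finset ι := {k | μ k < 0} with hN
  set P : Finset ι := {k | ¬ μ k < 0} with hP
  have hsplit : ∀ f : ι → ℝ, ∑ k, f k = ∑ k ∈ N, f k + ∑ k ∈ P, f k := fun f =>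
    (Finset.sum_filter_add_sum_filter_not _ _ _).symm
  have hPμ : ∀ k ∈ P, 0 ≤ μ k := fun k hk => by simpa [hP] using hk
  have hNμ : ∀ k ∈ N, μ k < 0 := fun k hk => by simpa [hN] using hk
  rcases N.eq_empty_or_nonempty with hE | hne
  · rw [hsplit, hE, Finset.sum_empty, zero_add]
    exact Finset.sum_nonneg fun k hk => mul_nonneg (hPμ k hk) (hr k)
  obtain ⟨d, hdN, hd⟩ := N.exists_max_image r hne
  set ν := ∑ k ∈ N, -μ k with hν
  have hν0 : 0 < ν := Finset.sum_pos (fun k hk => neg_pos.2 (hNμ k hk)) hne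
  have hPsum : 2 * t + ν ≤ ∑ k ∈ P, μ k := by
    have h := hsplit μ
    rw [Finset.sum_neg_distrib] at hν
    linarith
  have hPne : P.Nonempty := by
    by_contra h
    rw [Finset.not_nonempty_iff_eq_empty.1 h, Finset.sum_empty] at hPsum
    linarith
  obtain ⟨a, haP, ha⟩ := P.exists_min_image r hPne
  have hsa := Finset.add_sum_erase P μ haP
  have hPne' : (P.erase a).Nonempty := by
    by_contra h
    rw [Finset.not_nonempty_iff_eq_empty.1 h, Finset.sum_empty] at hsa
    linarith [hμ a]
  obtain ⟨b, hbP, hb⟩ := (P.erase a).exists_min_image r hPne'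
  have hsb := Finset.add_sum_erase _ μ hbP
  have hPne'' : ((P.erase a).erase b).Nonempty := by
    by_contra h
    rw [Finset.not_nonempty_iff_eq_empty.1 h, Finset.sum_empty] at hsb
    linarith [hμ a, hμ b]
  obtain ⟨c, hcP, hc⟩ := ((P.erase a).erase b).exists_min_image r hPne''
  have hba : b ≠ a := Finset.ne_of_mem_erase hbP
  have hcb : c ≠ b := Finset.ne_of_mem_erase hcP
  have hcP' : c ∈ P.erase a := Finset.mem_of_mem_erase hcP
  have hca : c ≠ a := Finset.ne_of_mem_erase hcP'
  have hPN : ∀ k ∈ P, k ≠ d := fun k hk h => not_lt.2 (hPμ k hk) (h ▸ hNμ d hdN)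
  have habc := hr3 a b c d hba.symm hca.symm (hPN a haP) hcb.symm
    (hPN b (Finset.mem_of_mem_erase hbP)) (hPN c (Finset.mem_of_mem_erase hcP'))
  have hrac : r a ≤ r c := ha c (Finset.mem_of_mem_erase hcP')
  have hrbc : r b ≤ r c := hb c hcP'
  have hrest : (∑ k ∈ (P.erase a).erase b, μ k) * r c ≤
      ∑ k ∈ (P.erase a).erase b, μ k * r k := by
    rw [Finset.sum_mul]
    exact Finset.sum_le_sum fun k hk => mul_le_mul_of_nonneg_left (hc k hk)
      (hPμ k (Finset.mem_of_mem_erase (Finset.mem_of_mem_erase hk)))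
  have hNsum : -(ν * r d) ≤ ∑ k ∈ N, μ k * r k := by
    rw [hν, Finset.sum_mul, ← Finset.sum_neg_distrib]
    refine Finset.sum_le_sum fun k hk => ?_
    nlinarith [hd k hk, hNμ k hk]
  have hPr : μ a * r a + (μ b * r b + (∑ k ∈ (P.erase a).erase b, μ k) * r c) ≤
      ∑ k ∈ P, μ k * r k := by
    rw [← Finset.add_sum_erase P (fun k => μ k * r k) haP,
      ← Finset.add_sum_erase _ (fun k => μ k * r k) hbP]
    linarith
  have hS : 2 * t + ν - μ a - μ b ≤ ∑ k ∈ (P.erase a).erase b, μ k := by linarith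
  have h1 := mul_le_mul_of_nonneg_right hS (hr c)
  have h2 := mul_nonneg (sub_nonneg.2 (hμ a)) (sub_nonneg.2 hrac)
  have h3 := mul_nonneg (sub_nonneg.2 (hμ b)) (sub_nonneg.2 hrbc)
  have h4 := mul_nonneg (sub_nonneg.2 hneg) (hr a)
  have h5 := mul_nonneg (sub_nonneg.2 hneg) (hr b)
  have h6 := mul_le_mul_of_nonneg_left habc hν0.le
  rw [hsplit]
  linarith

section SqrtPerm

variable {ι : Type*} [Fintype ι] [DecidableEq ι]

/-- A unitary square root of the permutation matrix of an involution `e`. -/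
def sqrtPerm (e : Equiv.Perm ι) : Matrix ι ι ℂ :=
  ((1 + Complex.I) / 2) • (1 : Matrix ι ι ℂ) + ((1 - Complex.I) / 2) • e.permMatrix ℂ

omit [Fintype ι] in
theorem conjTranspose_sqrtPerm {e : Equiv.Perm ι} (he : e⁻¹ = e) :
    (sqrtPerm e)ᴴ =
      ((1 - Complex.I) / 2) • (1 : Matrix ι ι ℂ) + ((1 + Complex.I) / 2) • e.permMatrix ℂ := by
  simp [sqrtPerm, conjTranspose_add, conjTranspose_smul, he, ← sub_eq_add_neg]

theorem sqrtPerm_mul_mul_conjTranspose_apply {e : Equiv.Perm ι} (he : e⁻¹ = e)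
    (σ : Matrix ι ι ℂ) (i j : ι) :
    (sqrtPerm e * σ * (sqrtPerm e)ᴴ) i j =
      (σ i j + σ (e i) (e j)) / 2 + Complex.I / 2 * (σ i (e j) - σ (e i) j) := by
  have he' : e.symm = e := he
  rw [conjTranspose_sqrtPerm he, sqrtPerm]
  simp only [Matrix.add_mul, Matrix.mul_add, Matrix.smul_mul, Matrix.mul_smul, Matrix.one_mul,
    Matrix.mul_one, Matrix.add_apply, Matrix.smul_apply, smul_eq_mul, PEquiv.toMatrix_toPEquiv_mul,
    PEquiv.mul_toMatrix_toPEquiv, Matrix.submatrix_apply, id, he']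
  linear_combination ((σ i (e j) + σ (e i) j - σ i j - σ (e i) (e j)) / 4) * Complex.I_sq

theorem sqrtPerm_mem_unitaryGroup {e : Equiv.Perm ι} (he : e⁻¹ = e) :
    sqrtPerm e ∈ Matrix.unitaryGroup ι ℂ := by
  rw [Matrix.mem_unitaryGroup_iff, star_eq_conjTranspose]
  ext i j
  have h := sqrtPerm_mul_mul_conjTranspose_apply he 1 i j
  rw [Matrix.mul_one] at h
  have hinv : ∀ k, e (e k) = k := fun k => by
    nth_rewrite 1 [← he]
    exact e.symm_apply_apply k
  have h1 : e i = j ↔ i = e j := ⟨fun h => by rw [← h, hinv], fun h => by rw [h, hinv]⟩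
  rw [h]
  simp [Matrix.one_apply, h1]

end SqrtPerm

theorem exists_perm_of_ne {α : Type*} [Finite α] {a b c d a' b' c' d' : α}
    (h : [a, b, c, d].Nodup) (h' : [a', b', c', d'].Nodup) :
    ∃ e : Equiv.Perm α, e a = a' ∧ e b = b' ∧ e c = c' ∧ e d = d' := by
  classical
  have inj : ∀ {a b c d : α}, [a, b, c, d].Nodup → Function.Injective ![a, b, c, d] := by
    intro a b c d h i j hij
    simp at h
    fin_cases i <;> fin_cases j <;> simp_all
  have hi := inj h
  have hi' := inj h'
  have := Fintype.ofFinite α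
  set e := ((Equiv.ofInjective _ hi).symm.trans (Equiv.ofInjective _ hi')).extendSubtype with he
  have key : ∀ i, e (![a, b, c, d] i) = ![a', b', c', d'] i := fun i => by
    rw [he, Equiv.extendSubtype_apply_of_mem _ _ ⟨i, rfl⟩]
    have : (Equiv.ofInjective _ hi).symm ⟨![a, b, c, d] i, ⟨i, rfl⟩⟩ = i :=
      Equiv.ofInjective_symm_apply hi i
    simp [this]
  exact ⟨e, key 0, key 1, key 2, key 3⟩

/-- Testing positivity of the partial transpose on a Bell vector. -/
theorem nonneg_of_posSemidef_partialTranspose {n : ℕ}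
    {τ : Matrix (Fin n × Fin n) (Fin n × Fin n) ℂ} (h : (partialTranspose τ).PosSemidef)
    (a b : Fin n) :
    0 ≤ τ (a, a) (a, a) + τ (b, b) (b, b) +
      Complex.I * (τ (a, b) (b, a) - τ (b, a) (a, b)) := by
  have := h.dotProduct_mulVec_nonneg (Pi.single (a, a) 1 + Pi.single (b, b) Complex.I)
  simp [Matrix.mulVec_add, star_add, Pi.star_single, partialTranspose] at this
  convert this using 1
  linear_combination τ (b, b) (b, b) * Complex.I_sq

theorem AbsolutelyPPT.apply_le_add_three {n : ℕ} (hn : 2 ≤ n)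
    {ρ : Matrix (Fin n × Fin n) (Fin n × Fin n) ℂ} (hppt : AbsolutelyPPT ρ)
    {U : Matrix (Fin n × Fin n) (Fin n × Fin n) ℂ}
    (hU : U ∈ Matrix.unitaryGroup (Fin n × Fin n) ℂ) {p q r s : Fin n × Fin n}
    (h : [p, q, r, s].Nodup) :
    (U * ρ * Uᴴ) s s ≤ (U * ρ * Uᴴ) p p + (U * ρ * Uᴴ) q q + (U * ρ * Uᴴ) r r := by
  obtain ⟨a, b, hab⟩ : ∃ a b : Fin n, a ≠ b :=
    ⟨⟨0, by omega⟩, ⟨1, by omega⟩, by simp⟩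
  obtain ⟨e, hp, hq, hr, hs⟩ := exists_perm_of_ne
    (a := (a, a)) (b := (b, b)) (c := (b, a)) (d := (a, b)) (by simp [hab, hab.symm]) h
  set f := Equiv.swap (a, b) (b, a) with hf
  have hfinv : f⁻¹ = f := Equiv.swap_inv _ _
  have hM : sqrtPerm f * (e.permMatrix ℂ * U) ∈ Matrix.unitaryGroup (Fin n × Fin n) ℂ := by
    refine mul_mem (sqrtPerm_mem_unitaryGroup hfinv) (mul_mem ?_ hU)
    rw [Matrix.mem_unitaryGroup_iff, star_eq_conjTranspose, conjTranspose_permMatrix,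
      ← permMatrix_mul]
    simp
  have hσ : ∀ i j, (e.permMatrix ℂ * U * ρ * (e.permMatrix ℂ * U)ᴴ) i j =
      (U * ρ * Uᴴ) (e i) (e j) := fun i j => by
    rw [conjTranspose_mul, conjTranspose_permMatrix]
    have : e.permMatrix ℂ * U * ρ * (Uᴴ * (e⁻¹).permMatrix ℂ) =
      e.permMatrix ℂ * (U * ρ * Uᴴ) * (e⁻¹).permMatrix ℂ := by simp only [Matrix.mul_assoc]
    rw [this, PEquiv.toMatrix_toPEquiv_mul, PEquiv.mul_toMatrix_toPEquiv]
    rfl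
  have key := nonneg_of_posSemidef_partialTranspose (hppt _ hM) a b
  have hassoc : sqrtPerm f * (e.permMatrix ℂ * U) * ρ * (sqrtPerm f * (e.permMatrix ℂ * U))ᴴ =
      sqrtPerm f * (e.permMatrix ℂ * U * ρ * (e.permMatrix ℂ * U)ᴴ) * (sqrtPerm f)ᴴ := by
    rw [conjTranspose_mul (sqrtPerm f)]
    simp only [Matrix.mul_assoc]
  have haa : f (a, a) = (a, a) := Equiv.swap_apply_of_ne_of_ne (by simp [hab]) (by simp [hab])
  have hbb : f (b, b) = (b, b) :=
    Equiv.swap_apply_of_ne_of_ne (by simp [hab.symm]) (by simp [hab.symm])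
  have h1 : f (a, b) = (b, a) := Equiv.swap_apply_left _ _
  have h2 : f (b, a) = (a, b) := Equiv.swap_apply_right _ _
  rw [hassoc] at key
  simp only [sqrtPerm_mul_mul_conjTranspose_apply hfinv, hσ, haa, hbb, h1, h2, hp, hq, hr, hs]
    at key
  rw [← sub_nonneg]
  convert key using 1
  linear_combination (-(U * ρ * Uᴴ) s s + (U * ρ * Uᴴ) r r) * Complex.I_sq

section ReducedAntisymm

variable {ι κ : Type*} [Fintype ι] [Fintype κ] [DecidableEq κ]

/-- The matrix `ρ₁ ⊗ I - (u uᴴ)^Γ`, where `ρ₁` is the first marginal of `u uᴴ` and `Γ` is the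
partial transpose on the second factor. -/
def reducedSubTranspose (u : ι × κ → ℂ) : Matrix (ι × κ) (ι × κ) ℂ :=
  Matrix.of fun p q => (if p.2 = q.2 then ∑ m, u (p.1, m) * star (u (q.1, m)) else 0) -
    u (p.1, q.2) * star (u (q.1, p.2))

omit [Fintype ι] in
theorem isHermitian_reducedSubTranspose (u : ι × κ → ℂ) :
    (reducedSubTranspose u).IsHermitian := by
  ext p q
  simp only [reducedSubTranspose, conjTranspose_apply, Matrix.of_apply, star_sub, star_mul',
    star_star, apply_ite star, star_sum, star_zero, eq_comm (a := q.2)]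
  simp only [mul_comm]

theorem trace_reducedSubTranspose (u : ι × κ → ℂ) :
    (reducedSubTranspose u).trace = (Fintype.card κ - 1 : ℂ) * ∑ p, u p * star (u p) := by
  simp only [Matrix.trace, Matrix.diag, reducedSubTranspose, Matrix.of_apply, if_true,
    Finset.sum_sub_distrib, Fintype.sum_prod_type, Finset.sum_const, Finset.card_univ,
    nsmul_eq_mul, ← Finset.mul_sum]
  ring

omit [DecidableEq κ] in
theorem sum_comm_reorder (f : κ → κ → ι → ι → ℂ) :
    ∑ k, ∑ l, ∑ i, ∑ j, f k l i j = ∑ i, ∑ l, ∑ j, ∑ k, f k l i j := by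
  rw [Finset.sum_comm]
  simp only [Finset.sum_comm (s := (Finset.univ : Finset κ)) (t := (Finset.univ : Finset ι))]

theorem star_dotProduct_reducedSubTranspose_mulVec (u x : ι × κ → ℂ) :
    star x ⬝ᵥ reducedSubTranspose u *ᵥ x =
      (∑ k, ∑ l, star (∑ i, (star (u (i, k)) * x (i, l) - star (u (i, l)) * x (i, k))) *
        ∑ i, (star (u (i, k)) * x (i, l) - star (u (i, l)) * x (i, k))) / 2 := by
  set M : κ → κ → ℂ := fun k l => ∑ i, star (u (i, k)) * x (i, l) with hM
  have hlhs : star x ⬝ᵥ reducedSubTranspose u *ᵥ x =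
      ∑ k, ∑ l, star (M k l) * M k l - ∑ k, ∑ l, star (M l k) * M k l := by
    have h1 : ∑ k, ∑ l, star (M k l) * M k l = ∑ i, ∑ l, star (x (i, l)) *
        ∑ j, (∑ m, u (i, m) * star (u (j, m))) * x (j, l) := by
      simp only [hM, star_sum, star_mul', star_star, Finset.sum_mul_sum]
      rw [sum_comm_reorder]
      simp only [Finset.sum_mul, Finset.mul_sum]
      refine Finset.sum_congr rfl fun i _ => Finset.sum_congr rfl fun l _ =>
        Finset.sum_congr rfl fun j _ => Finset.sum_congr rfl fun m _ => by ring
    have h2 : ∑ k, ∑ l, star (M l k) * M k l = ∑ i, ∑ k, star (x (i, k)) *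
        ∑ j, ∑ l, u (i, l) * star (u (j, k)) * x (j, l) := by
      simp only [hM, star_sum, star_mul', star_star, Finset.sum_mul_sum]
      rw [Finset.sum_comm, sum_comm_reorder]
      simp only [Finset.mul_sum]
      refine Finset.sum_congr rfl fun i _ => Finset.sum_congr rfl fun l _ =>
        Finset.sum_congr rfl fun j _ => Finset.sum_congr rfl fun m _ => by ring
    rw [h1, h2]
    simp only [dotProduct, mulVec, reducedSubTranspose, Matrix.of_apply, Fintype.sum_prod_type,
      sub_mul, Finset.sum_sub_distrib, mul_sub, ite_mul, zero_mul, Finset.sum_ite_eq,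
      Finset.mem_univ, if_true, Pi.star_apply]
  have hsub : ∀ k l, ∑ i, (star (u (i, k)) * x (i, l) - star (u (i, l)) * x (i, k)) =
      M k l - M l k := fun k l => Finset.sum_sub_distrib _ _
  simp only [hsub, hlhs, star_sub, sub_mul, mul_sub, Finset.sum_sub_distrib]
  rw [Finset.sum_comm (f := fun k l => star (M l k) * M l k),
    Finset.sum_comm (f := fun k l => star (M k l) * M l k)]
  ring

theorem re_star_dotProduct_reducedSubTranspose_mulVec (u x : ι × κ → ℂ) :
    (star x ⬝ᵥ reducedSubTranspose u *ᵥ x).re =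
      (∑ k, ∑ l, ‖∑ i, (star (u (i, k)) * x (i, l) - star (u (i, l)) * x (i, k))‖ ^ 2) / 2 := by
  rw [star_dotProduct_reducedSubTranspose_mulVec]
  have : ∀ z : ℂ, star z * z = ((‖z‖ ^ 2 : ℝ) : ℂ) := fun z => by
    simpa using Complex.conj_mul' z
  simp only [this]
  norm_cast

omit [DecidableEq κ] in
theorem sum_norm_sq_wedge_le (a x : κ → ℂ) :
    ∑ k, ∑ l, ‖star (a k) * x l - star (a l) * x k‖ ^ 2 ≤
      2 * (∑ k, ‖a k‖ ^ 2) * ∑ k, ‖x k‖ ^ 2 := by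
  have h : ((∑ k, ∑ l, ‖star (a k) * x l - star (a l) * x k‖ ^ 2 : ℝ) : ℂ) =
      ((2 * (∑ k, ‖a k‖ ^ 2) * (∑ k, ‖x k‖ ^ 2) - 2 * ‖∑ k, a k * x k‖ ^ 2 : ℝ) : ℂ) := by
    have hpt : ∀ k l, ((‖star (a k) * x l - star (a l) * x k‖ ^ 2 : ℝ) : ℂ) =
        ((‖a k‖ ^ 2 * ‖x l‖ ^ 2 : ℝ) : ℂ) + ((‖a l‖ ^ 2 * ‖x k‖ ^ 2 : ℝ) : ℂ) -
          star (a k * x k) * (a l * x l) - star (a l * x l) * (a k * x k) := fun k l => by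
      push_cast
      simp only [← Complex.conj_mul', map_sub, map_mul, Complex.star_def, Complex.conj_conj]
      ring
    have hP : ((‖∑ k, a k * x k‖ ^ 2 : ℝ) : ℂ) =
        ∑ k, ∑ l, star (a k * x k) * (a l * x l) := by
      push_cast
      rw [← Complex.conj_mul', map_sum, Finset.sum_mul_sum]
      rfl
    have hQ : (∑ k, ‖a k‖ ^ 2) * (∑ k, ‖x k‖ ^ 2) = ∑ k, ∑ l, ‖a k‖ ^ 2 * ‖x l‖ ^ 2 :=
      Finset.sum_mul_sum ..
    rw [mul_assoc, Complex.ofReal_sub, Complex.ofReal_mul 2 (‖_‖ ^ 2), hP, hQ]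
    simp only [Complex.ofReal_sum, hpt, Complex.ofReal_mul 2, Finset.sum_sub_distrib,
      Finset.sum_add_distrib]
    rw [Finset.sum_comm (f := fun k l => ((‖a l‖ ^ 2 * ‖x k‖ ^ 2 : ℝ) : ℂ)),
      Finset.sum_comm (f := fun k l => star (a l * x l) * (a k * x k))]
    push_cast
    ring
  have h' := Complex.ofReal_injective h
  nlinarith [sq_nonneg ‖∑ k, a k * x k‖]

theorem re_star_dotProduct_reducedSubTranspose_mulVec_le (u x : ι × κ → ℂ) :
    (star x ⬝ᵥ reducedSubTranspose u *ᵥ x).re ≤ (∑ p, ‖u p‖ ^ 2) * ∑ p, ‖x p‖ ^ 2 := by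
  rw [re_star_dotProduct_reducedSubTranspose_mulVec]
  set N : ι → EuclideanSpace ℂ (κ × κ) := fun i =>
    WithLp.toLp 2 fun p => star (u (i, p.1)) * x (i, p.2) - star (u (i, p.2)) * x (i, p.1) with hN
  have hsum : ∑ k, ∑ l, ‖∑ i, (star (u (i, k)) * x (i, l) - star (u (i, l)) * x (i, k))‖ ^ 2 =
      ‖∑ i, N i‖ ^ 2 := by
    rw [EuclideanSpace.norm_sq_eq, Fintype.sum_prod_type]
    simp [hN]
  set α : ι → ℝ := fun i => ∑ k, ‖u (i, k)‖ ^ 2 with hα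
  set β : ι → ℝ := fun i => ∑ k, ‖x (i, k)‖ ^ 2 with hβ
  have hα0 : ∀ i, 0 ≤ α i := fun i => by positivity
  have hβ0 : ∀ i, 0 ≤ β i := fun i => by positivity
  have hNi : ∀ i, ‖N i‖ ≤ √2 * (√(α i) * √(β i)) := fun i => by
    rw [← Real.sqrt_mul (hα0 i), ← Real.sqrt_mul (by norm_num), ← mul_assoc]
    refine Real.le_sqrt_of_sq_le ?_
    rw [EuclideanSpace.norm_sq_eq, Fintype.sum_prod_type]
    exact sum_norm_sq_wedge_le (fun k => u (i, k)) fun k => x (i, k)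
  have hle : ‖∑ i, N i‖ ≤ √2 * ∑ i, √(α i) * √(β i) := by
    rw [Finset.mul_sum]
    exact norm_sum_le_of_le _ fun i _ => hNi i
  have hcs := Finset.sum_mul_sq_le_sq_mul_sq Finset.univ (fun i => √(α i)) fun i => √(β i)
  simp only [Real.sq_sqrt (hα0 _), Real.sq_sqrt (hβ0 _)] at hcs
  rw [hsum, Fintype.sum_prod_type, Fintype.sum_prod_type]
  have h2 := pow_le_pow_left₀ (norm_nonneg _) hle 2
  rw [mul_pow, Real.sq_sqrt (by norm_num)] at h2
  linarith

end ReducedAntisymm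

theorem Matrix.IsHermitian.trace_mul_eq_sum_eigenvalues {ι : Type*} [Fintype ι] [DecidableEq ι]
    {W : Matrix ι ι ℂ} (hW : W.IsHermitian) (ρ : Matrix ι ι ℂ) :
    (ρ * W).trace = ∑ k, (hW.eigenvalues k : ℂ) *
      ((hW.eigenvectorUnitary : Matrix ι ι ℂ)ᴴ * ρ * (hW.eigenvectorUnitary : Matrix ι ι ℂ)) k k := by
  conv_lhs => rw [hW.spectral_theorem, Unitary.conjStarAlgAut_apply]
  rw [← Matrix.mul_assoc, ← Matrix.mul_assoc, Matrix.trace_mul_comm, ← Matrix.mul_assoc,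
    ← Matrix.mul_assoc]
  simp [Matrix.trace, Matrix.mul_diagonal, mul_comm, star_eq_conjTranspose]

theorem AbsolutelyPPT.trace_mul_nonneg {n : ℕ} (hn : 4 ≤ n)
    {ρ : Matrix (Fin n × Fin n) (Fin n × Fin n) ℂ} (hρ : ρ.PosSemidef) (hppt : AbsolutelyPPT ρ)
    {u v : Fin n × Fin n → ℂ} (huv : ∑ p, ‖u p‖ ^ 2 = ∑ p, ‖v p‖ ^ 2) :
    0 ≤ (ρ * (reducedSubTranspose u - vecMulVec v (star v))).trace := by
  have hW : (reducedSubTranspose u - vecMulVec v (star v)).IsHermitian :=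
    (isHermitian_reducedSubTranspose u).sub (posSemidef_vecMulVec_self_star v).isHermitian
  set t := ∑ p, ‖v p‖ ^ 2 with ht
  set U := hW.eigenvectorUnitary.1 with hU
  have hUmem : Uᴴ ∈ Matrix.unitaryGroup (Fin n × Fin n) ℂ := by
    rw [← star_eq_conjTranspose, hU]
    exact (star hW.eigenvectorUnitary).2
  set b := hW.eigenvectorBasis with hb
  set μ := hW.eigenvalues with hμdef
  have hdiag : ∀ k, 0 ≤ (Uᴴ * ρ * U) k k := fun k => (hρ.conjTranspose_mul_mul_same U).diag_nonneg
  have hunit : ∀ k, ∑ p, ‖(b k) p‖ ^ 2 = 1 := fun k => by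
    rw [← EuclideanSpace.norm_sq_eq, b.orthonormal.1 k, one_pow]
  have hμ : ∀ k, μ k = (star ⇑(b k) ⬝ᵥ reducedSubTranspose u *ᵥ ⇑(b k)).re -
      ‖inner ℂ (b k) (WithLp.toLp 2 v)‖ ^ 2 := fun k => by
    rw [hμdef, hW.eigenvalues_eq, Matrix.sub_mulVec, dotProduct_sub]
    have h1 : star ⇑(b k) ⬝ᵥ vecMulVec v (star v) *ᵥ ⇑(b k) =
        ((‖inner ℂ (b k) (WithLp.toLp 2 v)‖ ^ 2 : ℝ) : ℂ) := by
      have hz : inner ℂ (b k) (WithLp.toLp 2 v) = star ⇑(b k) ⬝ᵥ v := by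
        rw [EuclideanSpace.inner_eq_star_dotProduct, dotProduct_comm]
      push_cast
      rw [← Complex.mul_conj', hz, Matrix.vecMulVec_mulVec, op_smul_eq_smul, dotProduct_smul,
        smul_eq_mul, Matrix.star_dotProduct (v := v), mul_comm]
      rfl
    rw [← hb, h1]
    simp only [map_sub, RCLike.re_to_complex, Complex.ofReal_re]
  have hparseval : ∑ k, ‖inner ℂ (b k) (WithLp.toLp 2 v)‖ ^ 2 = t := by
    rw [b.sum_sq_norm_inner_right, EuclideanSpace.norm_sq_eq]
  have hR0 : ∀ x, 0 ≤ (star x ⬝ᵥ reducedSubTranspose u *ᵥ x).re := fun x => by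
    rw [re_star_dotProduct_reducedSubTranspose_mulVec]
    positivity
  have ht0 : 0 ≤ t := by positivity
  have htrace : ∑ k, μ k = (n - 2) * t := by
    have h1 := hW.trace_eq_sum_eigenvalues
    have hnorm : ∀ w : Fin n × Fin n → ℂ, ∑ p, w p * star (w p) = ((∑ p, ‖w p‖ ^ 2 : ℝ) : ℂ) :=
      fun w => by simp [← Complex.mul_conj']
    rw [Matrix.trace_sub, trace_reducedSubTranspose, Matrix.trace_vecMulVec, dotProduct] at h1
    simp only [Pi.star_apply, hnorm, huv, Fintype.card_fin, ← ht] at h1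
    apply Complex.ofReal_injective
    push_cast
    rw [hμdef]
    refine Eq.trans h1.symm ?_
    ring
  rw [hW.trace_mul_eq_sum_eigenvalues]
  have hcast : ∀ k, (Uᴴ * ρ * U) k k = (((Uᴴ * ρ * U) k k).re : ℂ) := fun k =>
    Complex.eq_re_of_ofReal_le (r := 0) (by simpa using hdiag k)
  rw [← hU, ← hμdef]
  have hfinal : 0 ≤ ∑ k, μ k * ((Uᴴ * ρ * U) k k).re := by
    refine sum_mul_nonneg_of_le_add_three μ _ t (fun k => (Complex.le_def.1 (hdiag k)).1) ?_ ?_ ?_ ?_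
    · intro k
      have h1 := re_star_dotProduct_reducedSubTranspose_mulVec_le u ⇑(b k)
      rw [hunit, mul_one, huv] at h1
      rw [hμ]
      nlinarith [sq_nonneg ‖inner ℂ (b k) (WithLp.toLp 2 v)‖]
    · rw [htrace]
      have : (4 : ℝ) ≤ n := by exact_mod_cast hn
      nlinarith
    · rw [← hparseval]
      refine (Finset.sum_le_sum fun k _ => ?_).trans
        (Finset.sum_le_sum_of_subset_of_nonneg (Finset.filter_subset _ _) fun k _ _ => sq_nonneg _)
      rw [hμ]
      linarith [hR0 ⇑(b k)]
    · intro p q r s h1 h2 h3 h4 h5 h6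
      have h := hppt.apply_le_add_three (by omega) hUmem (p := p) (q := q) (r := r) (s := s)
        (by simp [*])
      rw [conjTranspose_conjTranspose] at h
      simpa using (Complex.le_def.1 h).1
  have : ∑ k, (μ k : ℂ) * (Uᴴ * ρ * U) k k =
      ((∑ k, μ k * ((Uᴴ * ρ * U) k k).re : ℝ) : ℂ) := by
    push_cast
    exact Finset.sum_congr rfl fun k _ => by rw [← hcast k]
  rw [this]
  exact_mod_cast hfinal

/-- The sign of the nonzero entry in each row of `BHV n`. -/
def bhSign (n : ℕ) (k : Fin n) : ℂ := if (k : ℕ) < n / 2 then 1 else -1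

theorem star_bhSign {n : ℕ} (k : Fin n) : star (bhSign n k) = bhSign n k := by
  unfold bhSign
  split_ifs <;> simp

theorem norm_bhSign {n : ℕ} (k : Fin n) : ‖bhSign n k‖ = 1 := by
  unfold bhSign
  split_ifs <;> simp

theorem bhSign_mul_self {n : ℕ} (k : Fin n) : bhSign n k * bhSign n k = 1 := by
  unfold bhSign
  split_ifs <;> simp

theorem bhSign_rev {n : ℕ} (hne : Even n) (k : Fin n) : bhSign n k.rev = -bhSign n k := by
  obtain ⟨m, rfl⟩ := hne
  unfold bhSign
  rw [Fin.val_rev]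
  split_ifs <;> first | omega | simp

theorem BHV_apply {n : ℕ} (i j : Fin n) : BHV n i j = if j = i.rev then bhSign n i else 0 := by
  have : (j : ℕ) = n - 1 - (i : ℕ) ↔ j = i.rev := by
    rw [Fin.ext_iff, Fin.val_rev]
    omega
  simp [BHV, bhSign, this]

theorem PhiBH_apply {n : ℕ} (X : Matrix (Fin n) (Fin n) ℂ) (k l : Fin n) :
    PhiBH n X k l = (1 / ((n : ℂ) - 2)) * ((if k = l then ∑ m, X m m else 0) - X k l -
      bhSign n k * bhSign n l * X l.rev k.rev) := by
  have h : (BHV n * Xᵀ * (BHV n)ᴴ) k l = bhSign n k * bhSign n l * X l.rev k.rev := by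
    simp only [Matrix.mul_apply, BHV_apply, conjTranspose_apply, transpose_apply, ite_mul, zero_mul,
      Finset.sum_ite_eq', Finset.mem_univ, if_true, apply_ite star, star_zero, mul_ite, mul_zero,
      star_bhSign]
    ring
  rw [PhiBH, Matrix.smul_apply, Matrix.sub_apply, Matrix.sub_apply, h, Matrix.smul_apply,
    Matrix.one_apply, Matrix.trace, smul_eq_mul, smul_eq_mul, mul_ite, mul_one, mul_zero]
  rfl

theorem sum_sum_rev {n : ℕ} {M : Type*} [AddCommMonoid M] (f : Fin n → Fin n → M) :
    ∑ k, ∑ l, f k l = ∑ k, ∑ l, f (Fin.rev l) (Fin.rev k) := by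
  rw [Finset.sum_comm, ← Equiv.sum_comp Fin.revPerm]
  refine Finset.sum_congr rfl fun k _ => ?_
  rw [← Equiv.sum_comp Fin.revPerm]
  rfl

/-- The vector `(I ⊗ V) v`. -/
def bhFlip {n : ℕ} (v : Fin n × Fin n → ℂ) (p : Fin n × Fin n) : ℂ :=
  bhSign n p.2 * v (p.1, p.2.rev)

theorem sum_norm_sq_bhFlip {n : ℕ} (v : Fin n × Fin n → ℂ) :
    ∑ p, ‖bhFlip v p‖ ^ 2 = ∑ p, ‖v p‖ ^ 2 := by
  simp only [bhFlip, norm_mul, norm_bhSign, one_mul, Fintype.sum_prod_type]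
  exact Finset.sum_congr rfl fun i _ => Equiv.sum_comp Fin.revPerm fun k => ‖v (i, k)‖ ^ 2

/-- `id ⊗ Φ_BH` is self-adjoint, so its quadratic form at `v` is the pairing of `ρ` with its value
at `v vᴴ`. -/
theorem star_dotProduct_idTensor_PhiBH_mulVec {n : ℕ} (hne : Even n)
    (ρ : Matrix (Fin n × Fin n) (Fin n × Fin n) ℂ) (v : Fin n × Fin n → ℂ) :
    star v ⬝ᵥ idTensor (PhiBH n) ρ *ᵥ v = (1 / ((n : ℂ) - 2)) *
      (ρ * (reducedSubTranspose (bhFlip v) - vecMulVec v (star v))).trace := by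
  have hflip : ∀ i j, ∑ k, bhFlip v (j, k) * star (bhFlip v (i, k)) =
      ∑ k, v (j, k) * star (v (i, k)) := fun i j => by
    rw [← Equiv.sum_comp Fin.revPerm (fun k => v (j, k) * star (v (i, k)))]
    refine Finset.sum_congr rfl fun k _ => ?_
    simp only [bhFlip, star_mul', star_bhSign, Fin.revPerm_apply]
    linear_combination v (j, k.rev) * star (v (i, k.rev)) * bhSign_mul_self k
  have hlhs : star v ⬝ᵥ idTensor (PhiBH n) ρ *ᵥ v = (1 / ((n : ℂ) - 2)) *
      ∑ i, ∑ j, ∑ k, ∑ l, star (v (i, k)) * ((if k = l then ∑ m, ρ (i, m) (j, m) else 0) -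
        ρ (i, k) (j, l) - bhSign n k * bhSign n l * ρ (i, l.rev) (j, k.rev)) * v (j, l) := by
    simp only [dotProduct, mulVec, Fintype.sum_prod_type, idTensor, Matrix.of_apply, PhiBH_apply,
      Finset.mul_sum, Pi.star_apply]
    refine Finset.sum_congr rfl fun i _ => ?_
    rw [Finset.sum_comm]
    refine Finset.sum_congr rfl fun j _ => Finset.sum_congr rfl fun k _ =>
      Finset.sum_congr rfl fun l _ => by ring
  have hrhs : (ρ * (reducedSubTranspose (bhFlip v) - vecMulVec v (star v))).trace =
      ∑ i, ∑ j, ∑ k, ∑ l, ρ (i, k) (j, l) *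
        ((if l = k then ∑ m, v (j, m) * star (v (i, m)) else 0) -
          bhFlip v (j, k) * star (bhFlip v (i, l)) - v (j, l) * star (v (i, k))) := by
    simp only [Matrix.trace, Matrix.diag, Matrix.mul_apply, Fintype.sum_prod_type,
      Matrix.sub_apply, reducedSubTranspose, Matrix.of_apply, vecMulVec_apply, Pi.star_apply, hflip]
    exact Finset.sum_congr rfl fun i _ => Finset.sum_comm
  rw [hlhs, hrhs]
  congr 1
  refine Finset.sum_congr rfl fun i _ => Finset.sum_congr rfl fun j _ => ?_
  simp only [mul_sub, sub_mul, Finset.sum_sub_distrib, mul_ite, ite_mul, mul_zero, zero_mul,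
    Finset.sum_ite_eq, Finset.sum_ite_eq', Finset.mem_univ, if_true]
  have h1 : ∑ k, star (v (i, k)) * (∑ m, ρ (i, m) (j, m)) * v (j, k) =
      ∑ k, ρ (i, k) (j, k) * ∑ m, v (j, m) * star (v (i, m)) := by
    rw [← Finset.sum_mul, mul_comm (∑ k, ρ (i, k) (j, k)), Finset.sum_mul]
    exact Finset.sum_congr rfl fun k _ => by ring
  have h2 : ∑ k, ∑ l, star (v (i, k)) * ρ (i, k) (j, l) * v (j, l) =
      ∑ k, ∑ l, ρ (i, k) (j, l) * (v (j, l) * star (v (i, k))) :=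
    Finset.sum_congr rfl fun k _ => Finset.sum_congr rfl fun l _ => by ring
  have h3 : ∑ k, ∑ l, star (v (i, k)) *
        (bhSign n k * bhSign n l * ρ (i, l.rev) (j, k.rev)) * v (j, l) =
      ∑ k, ∑ l, ρ (i, k) (j, l) * (bhFlip v (j, k) * star (bhFlip v (i, l))) := by
    rw [sum_sum_rev]
    refine Finset.sum_congr rfl fun k _ => Finset.sum_congr rfl fun l _ => ?_
    simp only [Fin.rev_rev, bhSign_rev hne, bhFlip, star_mul', star_bhSign]
    ring
  rw [h1, h2, h3]
  ring

theorem isHermitian_idTensor_PhiBH {n : ℕ} {ρ : Matrix (Fin n × Fin n) (Fin n × Fin n) ℂ}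
    (hρ : ρ.IsHermitian) : (idTensor (PhiBH n) ρ).IsHermitian := by
  ext p q
  have h : ∀ p q, star (ρ p q) = ρ q p := fun p q => hρ.apply q p
  simp only [conjTranspose_apply, idTensor, Matrix.of_apply, PhiBH_apply, star_mul', star_sub,
    apply_ite star, star_sum, star_zero, h, star_bhSign, eq_comm (a := q.2)]
  simp only [star_div₀, star_sub, star_one, star_natCast, star_ofNat]
  ring

/-- The Breuer–Hall map cannot detect entanglement in any absolutely PPT state on
`ℂⁿ ⊗ ℂⁿ` for even `n ≥ 4`. -/
theorem breuer_hall_of_absPPT {n : ℕ} (hn : 4 ≤ n) (hne : Even n)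
    (ρ : Matrix (Fin n × Fin n) (Fin n × Fin n) ℂ)
    (hρ : ρ.PosSemidef) (htr : ρ.trace = 1) (hppt : AbsolutelyPPT ρ) :
    (idTensor (PhiBH n) ρ).PosSemidef := by
  refine PosSemidef.of_dotProduct_mulVec_nonneg (isHermitian_idTensor_PhiBH hρ.isHermitian)
    fun v => ?_
  rw [star_dotProduct_idTensor_PhiBH_mulVec hne]
  refine mul_nonneg ?_ (hppt.trace_mul_nonneg hn hρ (sum_norm_sq_bhFlip v))
  have h : (0 : ℝ) ≤ 1 / ((n : ℝ) - 2) := by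
    have : (4 : ℝ) ≤ n := by exact_mod_cast hn
    exact one_div_nonneg.2 (by linarith)
  simpa using Complex.zero_le_real.2 h

end
end

section
/- Let n ≥ 2 and let α be a real number with −1/n ≤ α ≤ 1/n. Then the Werner state ρ = (1/(n² − nα))·(I − α·S) on ℂ^n ⊗ ℂ^n, where S is the swap operator, is absolutely separable. -/
open Matrix BigOperators
open scoped ComplexOrder

noncomputable section

/-- A matrix is separable if it is a finite sum of Kronecker products of
positive semidefinite matrices. -/
def Separable {m n : ℕ} (σ : Matrix (Fin m × Fin n) (Fin m × Fin n) ℂ) : Prop :=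
  ∃ (k : ℕ) (A : Fin k → Matrix (Fin m) (Fin m) ℂ) (B : Fin k → Matrix (Fin n) (Fin n) ℂ),
    (∀ i, (A i).PosSemidef) ∧ (∀ i, (B i).PosSemidef) ∧
      σ = ∑ i, Matrix.kroneckerMap (· * ·) (A i) (B i)

/-- A state is absolutely separable if every unitary conjugate of it is separable. -/
def AbsolutelySeparable {m n : ℕ} (ρ : Matrix (Fin m × Fin n) (Fin m × Fin n) ℂ) : Prop :=
  ∀ U : Matrix (Fin m × Fin n) (Fin m × Fin n) ℂ,
    U ∈ Matrix.unitaryGroup (Fin m × Fin n) ℂ →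
      Separable (U * ρ * Uᴴ)


/-- The swap operator on `ℂⁿ ⊗ ℂⁿ`. -/
def swapOp (n : ℕ) : Matrix (Fin n × Fin n) (Fin n × Fin n) ℂ :=
  Matrix.of fun p q => if p.1 = q.2 ∧ p.2 = q.1 then 1 else 0


section UnitaryDiagonalization

variable {ι : Type*} [Fintype ι] [DecidableEq ι]

/-- Every unitary matrix is unitarily diagonalizable, with eigenvalues of modulus one. -/
theorem exists_diagonalization_of_mem_unitaryGroup {W : Matrix ι ι ℂ}
    (hW : W ∈ unitaryGroup ι ℂ) :
    ∃ V ∈ unitaryGroup ι ℂ, ∃ d : ι → ℂ, (∀ k, d k * star (d k) = 1) ∧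
      W = V * diagonal d * Vᴴ := by
  have hWW : Wᴴ * W = 1 := mem_unitaryGroup_iff'.1 hW
  obtain ⟨z, hz, hdet⟩ : ∃ z : ℂ, star z * z = 1 ∧ (z • (1 : Matrix ι ι ℂ) + W).det ≠ 0 := by
    have hinf : (Metric.sphere (0 : ℂ) 1).Infinite :=
      (isPreconnected_sphere (by simp) 0 1).infinite_of_nontrivial
        ⟨1, by simp, -1, by simp, by norm_num⟩
    have hne : (-W).charpoly ≠ 0 := (charpoly_monic _).ne_zero
    obtain ⟨z, hz, hz'⟩ := hinf.exists_notMem_finset (-W).charpoly.roots.toFinset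
    refine ⟨z, ?_, ?_⟩
    · have h1 : ‖z‖ = 1 := by simpa using hz
      rw [Complex.star_def, ← Complex.normSq_eq_conj_mul_self, Complex.normSq_eq_norm_sq, h1]
      simp
    · intro h
      apply hz'
      rw [Multiset.mem_toFinset, Polynomial.mem_roots hne, Polynomial.IsRoot, eval_charpoly]
      rw [← h]
      congr 1
      ext i j
      simp [scalar_apply, diagonal_apply, one_apply]
  set A : Matrix ι ι ℂ := z • 1 + W with hA
  set B : Matrix ι ι ℂ := z • 1 - W with hB
  have hAu : IsUnit A.det := isUnit_iff_ne_zero.2 hdet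
  have hAB : Aᴴ * B = z • Wᴴ - star z • W := by
    rw [hA, hB, conjTranspose_add, conjTranspose_smul, conjTranspose_one, add_mul, mul_sub,
      mul_sub, hWW]
    simp only [smul_mul_smul, mul_one, hz, Matrix.mul_smul, Matrix.smul_mul, one_mul, one_smul]
    abel
  have hherm : (Complex.I • (Aᴴ * B)).IsHermitian := by
    rw [hAB, IsHermitian]
    simp only [conjTranspose_smul, conjTranspose_sub, conjTranspose_conjTranspose,
      Complex.star_def, Complex.conj_I, Complex.conj_conj]
    rw [neg_smul, ← smul_neg, neg_sub]
  set K : Matrix ι ι ℂ := (A⁻¹)ᴴ * (Complex.I • (Aᴴ * B)) * A⁻¹ with hK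
  have hKh : K.IsHermitian := isHermitian_conjTranspose_mul_mul _ hherm
  have hKA : K * A = Complex.I • B := by
    rw [hK, Matrix.mul_assoc, nonsing_inv_mul _ hAu, Matrix.mul_one, Matrix.mul_smul,
      ← Matrix.mul_assoc, ← conjTranspose_mul, mul_nonsing_inv _ hAu, conjTranspose_one,
      Matrix.one_mul]
  set V : Matrix ι ι ℂ := hKh.eigenvectorUnitary.1 with hV
  have hVmem : V ∈ unitaryGroup ι ℂ := hKh.eigenvectorUnitary.2
  have hVV : Vᴴ * V = 1 := mem_unitaryGroup_iff'.1 hVmem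
  have hVV' : V * Vᴴ = 1 := mem_unitaryGroup_iff.1 hVmem
  set L : Matrix ι ι ℂ := diagonal (fun k => (hKh.eigenvalues k : ℂ)) with hL
  have hspec : K = V * L * Vᴴ := by
    have := hKh.spectral_theorem
    rw [Unitary.conjStarAlgAut_apply] at this
    exact this
  set M : Matrix ι ι ℂ := Vᴴ * W * V with hM
  have hWM : W = V * M * Vᴴ := by
    rw [hM]
    simp only [Matrix.mul_assoc, hVV', Matrix.mul_one]
    rw [← Matrix.mul_assoc, hVV', Matrix.one_mul]
  have hMM : M * Mᴴ = 1 := by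
    have hWW' : W * Wᴴ = 1 := mem_unitaryGroup_iff.1 hW
    rw [hM]
    simp only [conjTranspose_mul, conjTranspose_conjTranspose, Matrix.mul_assoc]
    rw [← Matrix.mul_assoc V, hVV', Matrix.one_mul, ← Matrix.mul_assoc W, hWW', Matrix.one_mul, hVV]
  have hLM : L * (z • 1 + M) = Complex.I • (z • 1 - M) := by
    have h := congrArg (fun X => Vᴴ * X * V) hKA
    simp only [hspec, hA, hB] at h
    have e1 : Vᴴ * (V * L * Vᴴ * (z • 1 + W)) * V = L * (z • 1 + M) := by
      simp only [hM, Matrix.mul_add, Matrix.add_mul, Matrix.mul_smul, Matrix.smul_mul,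
        Matrix.mul_one, Matrix.mul_assoc, hVV]
      simp only [← Matrix.mul_assoc, hVV, Matrix.one_mul]
    have e2 : Vᴴ * (Complex.I • (z • 1 - W)) * V = Complex.I • (z • 1 - M) := by
      simp only [hM, Matrix.mul_sub, Matrix.sub_mul, Matrix.mul_smul, Matrix.smul_mul,
        Matrix.mul_one, hVV]
    rw [e1, e2] at h
    exact h
  have hoff : ∀ a b, a ≠ b → M a b = 0 := by
    intro a b hab
    have h := congrFun (congrFun hLM a) b
    simp only [hL, diagonal_mul, Matrix.add_apply, Matrix.sub_apply, Matrix.smul_apply,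
      one_apply_ne hab, smul_eq_mul] at h
    have h0 : ((hKh.eigenvalues a : ℂ) + Complex.I) * M a b = 0 := by linear_combination h
    rcases mul_eq_zero.1 h0 with h1 | h1
    · have := congrArg Complex.im h1
      simp at this
    · exact h1
  have hMd : M = diagonal (fun k => M k k) := by
    ext a b
    by_cases hab : a = b
    · subst hab; simp
    · rw [diagonal_apply_ne _ hab, hoff a b hab]
  refine ⟨V, hVmem, fun k => M k k, fun k => ?_, by rw [← hMd]; exact hWM⟩
  have h := congrFun (congrFun hMM k) k
  rw [hMd, diagonal_conjTranspose, diagonal_mul_diagonal] at h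
  simpa using h

/-- A matrix of Frobenius norm at most one is the average of two unitary matrices. -/
theorem exists_unitary_average {D : Matrix ι ι ℂ} (hD : ∑ a, ∑ b, ‖D a b‖ ^ 2 ≤ 1) :
    ∃ W₁ ∈ unitaryGroup ι ℂ, ∃ W₂ ∈ unitaryGroup ι ℂ,
      D = (1 / 2 : ℂ) • W₁ + (1 / 2 : ℂ) • W₂ := by
  have hG : (Dᴴ * D).PosSemidef := posSemidef_conjTranspose_mul_self D
  set l := hG.1.eigenvalues with hl
  have hl0 : ∀ k, 0 ≤ l k := hG.eigenvalues_nonneg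
  set V : Matrix ι ι ℂ := hG.1.eigenvectorUnitary.1 with hV
  have hVmem : V ∈ unitaryGroup ι ℂ := hG.1.eigenvectorUnitary.2
  have hVV : Vᴴ * V = 1 := mem_unitaryGroup_iff'.1 hVmem
  have hVV' : V * Vᴴ = 1 := mem_unitaryGroup_iff.1 hVmem
  have hspec : Dᴴ * D = V * diagonal (fun k => (l k : ℂ)) * Vᴴ := by
    have := hG.1.spectral_theorem
    rw [Unitary.conjStarAlgAut_apply] at this
    exact this
  have hsum : ∑ k, l k ≤ 1 := by
    have h1 : (∑ k, l k : ℂ) = ((∑ a, ∑ b, ‖D a b‖ ^ 2 : ℝ) : ℂ) := by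
      have := hG.1.trace_eq_sum_eigenvalues
      simp only [Complex.coe_algebraMap] at this
      rw [← hl] at this
      rw [← this, trace, Finset.sum_comm]
      push_cast
      refine Finset.sum_congr rfl fun i _ => ?_
      rw [diag_apply, mul_apply]
      refine Finset.sum_congr rfl fun j _ => ?_
      rw [conjTranspose_apply, Complex.star_def, Complex.conj_mul']
    have h2 : ∑ k, l k = ∑ a, ∑ b, ‖D a b‖ ^ 2 := by exact_mod_cast h1
    exact h2.le.trans hD
  have hl1 : ∀ k, l k ≤ 1 := fun k =>
    (Finset.single_le_sum (fun i _ => hl0 i) (Finset.mem_univ k)).trans hsum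
  set M := D * V with hM
  have hMM : Mᴴ * M = diagonal (fun k => (l k : ℂ)) := by
    rw [hM, conjTranspose_mul, Matrix.mul_assoc, ← Matrix.mul_assoc Dᴴ, hspec]
    simp only [Matrix.mul_assoc, hVV, Matrix.mul_one]
    rw [← Matrix.mul_assoc, hVV, Matrix.one_mul]
  let m : ι → EuclideanSpace ℂ ι := fun k => WithLp.toLp 2 (fun i => M i k)
  have hinner : ∀ j k, inner ℂ (m j) (m k) = if j = k then (l k : ℂ) else 0 := by
    intro j k
    have h := congrFun (congrFun hMM j) k
    rw [mul_apply, diagonal_apply] at h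
    simp only [m, PiLp.inner_apply, RCLike.inner_apply]
    simp only [conjTranspose_apply, Complex.star_def] at h
    rw [show (if j = k then (l k : ℂ) else 0) = if j = k then (l j : ℂ) else 0 by
      split_ifs with e <;> simp [e], ← h]
    exact Finset.sum_congr rfl fun i _ => mul_comm _ _
  let s : Set ι := {k | l k ≠ 0}
  let v : ι → EuclideanSpace ℂ ι := fun k => ((Real.sqrt (l k))⁻¹ : ℂ) • m k
  have hv : Orthonormal ℂ (s.domRestrict v) := by
    rw [orthonormal_iff_ite]
    rintro ⟨j, hj⟩ ⟨k, hk⟩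
    simp only [Set.domRestrict_apply, v, inner_smul_left, inner_smul_right, hinner,
      Subtype.mk.injEq]
    split_ifs with e
    · subst e
      have hs : (Real.sqrt (l j) : ℂ) * Real.sqrt (l j) = l j := by
        exact_mod_cast Real.mul_self_sqrt (hl0 j)
      have hs0 : (Real.sqrt (l j) : ℂ) ≠ 0 := by
        exact_mod_cast (Real.sqrt_pos.2 (lt_of_le_of_ne (hl0 j) (Ne.symm hj))).ne'
      rw [map_inv₀, Complex.conj_ofReal]
      field_simp
      rw [← hs]; ring
    · simp
  obtain ⟨b, hb⟩ := hv.exists_orthonormalBasis_extension_of_card_eq (by simp)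
  let Q : Matrix ι ι ℂ := Matrix.of fun i k => b k i
  have hQQ : Qᴴ * Q = 1 := by
    ext j k
    have h := orthonormal_iff_ite.1 b.orthonormal j k
    rw [PiLp.inner_apply] at h
    rw [mul_apply, one_apply, ← h]
    exact Finset.sum_congr rfl fun i _ => by simp [Q, mul_comm]
  have hQmem : Q ∈ unitaryGroup ι ℂ := mem_unitaryGroup_iff'.2 hQQ
  have hMQ : M = Q * diagonal (fun k => (Real.sqrt (l k) : ℂ)) := by
    ext i k
    rw [mul_diagonal]
    by_cases hk : l k = 0
    · have h0 : m k = 0 := by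
        rw [← inner_self_eq_zero (𝕜 := ℂ), hinner]; simp [hk]
      have : M i k = m k i := rfl
      rw [this, h0, hk]; simp
    · have hs0 : (Real.sqrt (l k) : ℂ) ≠ 0 := by
        exact_mod_cast (Real.sqrt_pos.2 (lt_of_le_of_ne (hl0 k) (Ne.symm hk))).ne'
      have : Q i k = (Real.sqrt (l k) : ℂ)⁻¹ * M i k := by
        change b k i = _
        rw [hb k hk]
        simp [v, m]
      rw [this]
      field_simp
  have hphase : ∀ d : ι → ℂ, (∀ k, d k * star (d k) = 1) →
      Q * diagonal d * Vᴴ ∈ unitaryGroup ι ℂ := by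
    intro d hd
    refine mul_mem (mul_mem hQmem ?_) (Unitary.star_mem hVmem)
    rw [mem_unitaryGroup_iff, star_eq_conjTranspose, diagonal_conjTranspose,
      diagonal_mul_diagonal, ← diagonal_one]
    congr 1
    ext k
    exact hd k
  have hsq : ∀ k, (Real.sqrt (l k) : ℂ) * Real.sqrt (l k)
      + (Real.sqrt (1 - l k) : ℂ) * Real.sqrt (1 - l k) = 1 := by
    intro k
    have h1 := Real.mul_self_sqrt (hl0 k)
    have h2 := Real.mul_self_sqrt (sub_nonneg.2 (hl1 k))
    exact_mod_cast (by linarith :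
      Real.sqrt (l k) * Real.sqrt (l k) + Real.sqrt (1 - l k) * Real.sqrt (1 - l k) = 1)
  refine ⟨_, hphase (fun k => Real.sqrt (l k) + Complex.I * Real.sqrt (1 - l k)) ?_,
    _, hphase (fun k => Real.sqrt (l k) - Complex.I * Real.sqrt (1 - l k)) ?_, ?_⟩
  · intro k
    simp only [Complex.star_def, map_add, map_mul, Complex.conj_ofReal, Complex.conj_I]
    linear_combination hsq k - (Real.sqrt (1 - l k) : ℂ) ^ 2 * Complex.I_sq
  · intro k
    simp only [Complex.star_def, map_sub, map_mul, Complex.conj_ofReal, Complex.conj_I]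
    linear_combination hsq k - (Real.sqrt (1 - l k) : ℂ) ^ 2 * Complex.I_sq
  · rw [← smul_add, ← Matrix.add_mul, ← Matrix.mul_add, diagonal_add]
    have hd : D = M * Vᴴ := by rw [hM, Matrix.mul_assoc, hVV', Matrix.mul_one]
    rw [hd, hMQ, ← Matrix.smul_mul, ← Matrix.mul_smul, ← diagonal_smul]
    congr 3
    ext k
    simp only [Pi.smul_apply, smul_eq_mul]
    ring

end UnitaryDiagonalization

section Separability

open scoped Kronecker

variable {m n : ℕ}

theorem Separable.kronecker {A : Matrix (Fin m) (Fin m) ℂ} {B : Matrix (Fin n) (Fin n) ℂ}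
    (hA : A.PosSemidef) (hB : B.PosSemidef) : Separable (A ⊗ₖ B) :=
  ⟨1, fun _ => A, fun _ => B, fun _ => hA, fun _ => hB, by simp⟩

theorem Separable.zero : Separable (0 : Matrix (Fin m × Fin n) (Fin m × Fin n) ℂ) :=
  ⟨0, fun _ => 0, fun _ => 0, fun _ => .zero, fun _ => .zero, by simp⟩

theorem Separable.add {X Y : Matrix (Fin m × Fin n) (Fin m × Fin n) ℂ}
    (hX : Separable X) (hY : Separable Y) : Separable (X + Y) := by
  obtain ⟨k, A, B, hA, hB, rfl⟩ := hX
  obtain ⟨l, A', B', hA', hB', rfl⟩ := hY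
  refine ⟨k + l, Fin.append A A', Fin.append B B', ?_, ?_, ?_⟩
  · exact Fin.addCases (by simpa using hA) (by simpa using hA')
  · exact Fin.addCases (by simpa using hB) (by simpa using hB')
  · simp [Fin.sum_univ_add]

theorem Separable.smul {X : Matrix (Fin m × Fin n) (Fin m × Fin n) ℂ}
    (hX : Separable X) {c : ℝ} (hc : 0 ≤ c) : Separable ((c : ℂ) • X) := by
  obtain ⟨k, A, B, hA, hB, rfl⟩ := hX
  refine ⟨k, fun i => (c : ℂ) • A i, B, fun i => (hA i).smul (by exact_mod_cast hc), hB, ?_⟩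
  rw [Finset.smul_sum]
  exact Finset.sum_congr rfl fun i _ => (smul_kronecker _ _ _).symm

theorem Separable.sum {κ : Type*} (s : Finset κ)
    {X : κ → Matrix (Fin m × Fin n) (Fin m × Fin n) ℂ} (hX : ∀ k ∈ s, Separable (X k)) :
    Separable (∑ k ∈ s, X k) :=
  Finset.sum_induction X Separable (fun _ _ => Separable.add) Separable.zero hX

theorem separable_pair_of_unitary (i j : Fin m) {t t' ν : ℝ} (ht : 0 ≤ t) (ht' : 0 ≤ t')
    (hν : 0 ≤ ν) (hνt : ν ^ 2 = t * t') {W : Matrix (Fin n) (Fin n) ℂ}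
    (hW : W ∈ unitaryGroup (Fin n) ℂ) :
    Separable ((t : ℂ) • (single i i (1 : ℂ) ⊗ₖ (1 : Matrix (Fin n) (Fin n) ℂ))
      + (t' : ℂ) • (single j j (1 : ℂ) ⊗ₖ (1 : Matrix (Fin n) (Fin n) ℂ))
      + (ν : ℂ) • (single i j (1 : ℂ) ⊗ₖ W + single j i (1 : ℂ) ⊗ₖ Wᴴ)) := by
  obtain ⟨V, hV, d, hd, rfl⟩ := exists_diagonalization_of_mem_unitaryGroup hW
  have hVV : V * Vᴴ = 1 := mem_unitaryGroup_iff.1 hV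
  let δ : Fin m → Fin m → ℂ := fun u a => if a = u then 1 else 0
  let p : Fin n → Fin m → ℂ := fun k a =>
    Real.sqrt t * δ i a + Real.sqrt t' * star (d k) * δ j a
  have hst : (Real.sqrt t : ℂ) * Real.sqrt t = t := by exact_mod_cast Real.mul_self_sqrt ht
  have hst' : (Real.sqrt t' : ℂ) * Real.sqrt t' = t' := by
    exact_mod_cast Real.mul_self_sqrt ht'
  have hsν : (Real.sqrt t : ℂ) * Real.sqrt t' = ν := by
    rw [← Complex.ofReal_mul, ← Real.sqrt_mul ht, ← hνt, Real.sqrt_sq hν]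
  have hpp : ∀ k a b, p k a * star (p k b) = t * single i i (1 : ℂ) a b
      + t' * single j j (1 : ℂ) a b
      + ν * (single i j (1 : ℂ) a b * d k + single j i (1 : ℂ) a b * star (d k)) := by
    intro k a b
    have hsingle : ∀ u v : Fin m, single u v (1 : ℂ) a b = δ u a * δ v b := by
      intro u v
      simp only [δ, single_apply, ite_and, eq_comm (a := u), eq_comm (a := v), ite_mul, one_mul,
        zero_mul]
    have hδ : ∀ u, star (δ u b) = δ u b := fun u => by
      simp only [δ, apply_ite star, star_one, star_zero]
    have hreal : ∀ x : ℝ, star (x : ℂ) = x := Complex.conj_ofReal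
    simp only [hsingle, p, star_add, star_mul', star_star, hδ, hreal]
    linear_combination δ i a * δ i b * hst + δ j a * δ j b * (d k * star (d k)) * hst'
      + t' * δ j a * δ j b * hd k
      + (δ i a * δ j b * d k + δ j a * δ i b * star (d k)) * hsν
  have hsum : ∀ c e, ∑ k, V c k * star (V e k) = (1 : Matrix (Fin n) (Fin n) ℂ) c e := by
    intro c e
    rw [← hVV, mul_apply]
    rfl
  have hsumd : ∀ c e, ∑ k, d k * (V c k * star (V e k)) = (V * diagonal d * Vᴴ) c e := by
    intro c e
    rw [mul_apply]
    refine Finset.sum_congr rfl fun k _ => ?_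
    rw [mul_diagonal, conjTranspose_apply]
    ring
  have hsumd' : ∀ c e, ∑ k, star (d k) * (V c k * star (V e k))
      = (V * diagonal d * Vᴴ)ᴴ c e := by
    intro c e
    rw [conjTranspose_apply, ← hsumd, star_sum]
    refine Finset.sum_congr rfl fun k _ => ?_
    simp only [star_mul', star_star]
    ring
  have key := Separable.sum Finset.univ (fun k (_ : k ∈ Finset.univ) =>
    Separable.kronecker (posSemidef_vecMulVec_self_star (p k))
      (posSemidef_vecMulVec_self_star fun c => V c k))
  convert key using 1
  ext ⟨a, c⟩ ⟨b, e⟩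
  simp only [Matrix.add_apply, Matrix.smul_apply, smul_eq_mul, kroneckerMap_apply, Matrix.sum_apply,
    vecMulVec_apply, Pi.star_apply]
  simp only [hpp, add_mul, mul_add, Finset.sum_add_distrib]
  simp only [mul_assoc, ← Finset.mul_sum, hsum, hsumd, hsumd']

theorem separable_pair (i j : Fin m) {t t' ν : ℝ} (ht : 0 ≤ t) (ht' : 0 ≤ t')
    (hν : 0 ≤ ν) (hνt : ν ^ 2 = t * t') {D : Matrix (Fin n) (Fin n) ℂ}
    (hD : ∑ a, ∑ b, ‖D a b‖ ^ 2 ≤ 1) :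
    Separable ((t : ℂ) • (single i i (1 : ℂ) ⊗ₖ (1 : Matrix (Fin n) (Fin n) ℂ))
      + (t' : ℂ) • (single j j (1 : ℂ) ⊗ₖ (1 : Matrix (Fin n) (Fin n) ℂ))
      + (ν : ℂ) • (single i j (1 : ℂ) ⊗ₖ D + single j i (1 : ℂ) ⊗ₖ Dᴴ)) := by
  obtain ⟨W₁, hW₁, W₂, hW₂, rfl⟩ := exists_unitary_average hD
  have h := ((separable_pair_of_unitary i j ht ht' hν hνt hW₁).add
    (separable_pair_of_unitary i j ht ht' hν hνt hW₂)).smul (c := 1 / 2) (by norm_num)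
  convert h using 1
  ext ⟨a, c⟩ ⟨b, e⟩
  simp only [Matrix.add_apply, Matrix.smul_apply, smul_eq_mul, kroneckerMap_apply, conjTranspose_apply,
    star_add, star_mul', Complex.star_def, map_div₀, map_one, map_ofNat]
  push_cast
  ring

/-- The Gurvits-Barnum ball: a Hermitian perturbation of the identity of Frobenius norm at most
one is separable. -/
theorem separable_one_add {Δ : Matrix (Fin m × Fin n) (Fin m × Fin n) ℂ}
    (hΔ : Δ.IsHermitian) (hnorm : ∑ p, ∑ q, ‖Δ p q‖ ^ 2 ≤ 1) : Separable (1 + Δ) := by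
  let Q : Fin m → Fin m → ℝ := fun i j => ∑ a, ∑ b, ‖Δ (i, a) (j, b)‖ ^ 2
  have hQ0 : ∀ i j, 0 ≤ Q i j := fun i j => by positivity
  have hQs : ∀ i j, Q i j = Q j i := by
    intro i j
    simp only [Q]
    rw [Finset.sum_comm]
    refine Finset.sum_congr rfl fun b _ => Finset.sum_congr rfl fun a _ => ?_
    rw [← hΔ.apply, norm_star]
  have hQ1 : ∑ i, ∑ j, Q i j ≤ 1 := by
    refine le_of_eq_of_le ?_ hnorm
    simp only [Fintype.sum_prod_type, Q]
    refine Finset.sum_congr rfl fun i _ => ?_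
    rw [Finset.sum_comm]
  let N : Fin m → Fin m → ℝ := fun i j => Real.sqrt (Q i j)
  have hN0 : ∀ i j, 0 ≤ N i j := fun i j => Real.sqrt_nonneg _
  have hNs : ∀ i j, N i j = N j i := fun i j => by simp only [N, hQs i j]
  have hN2 : ∀ i j, N i j ^ 2 = Q i j := fun i j => Real.sq_sqrt (hQ0 i j)
  let r : Fin m → ℝ := fun i => Real.sqrt (∑ j, Q i j)
  have hr0 : ∀ i, 0 ≤ r i := fun i => Real.sqrt_nonneg _
  have hr2 : ∀ i, r i ^ 2 = ∑ j, Q i j :=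
    fun i => Real.sq_sqrt (Finset.sum_nonneg fun j _ => hQ0 i j)
  have hNr : ∀ i j, N i j ≤ r i := fun i j =>
    Real.sqrt_le_sqrt (Finset.single_le_sum (fun k _ => hQ0 i k) (Finset.mem_univ j))
  let t : Fin m → Fin m → ℝ := fun i j => N i j * r j / r i
  have ht0 : ∀ i j, 0 ≤ t i j := fun i j => div_nonneg (mul_nonneg (hN0 i j) (hr0 j)) (hr0 i)
  have htt : ∀ i j, N i j ^ 2 = t i j * t j i := by
    intro i j
    simp only [t]
    rw [hNs j i]
    rcases (hr0 i).eq_or_lt with hi | hi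
    · have : N i j = 0 := le_antisymm (hi ▸ hNr i j) (hN0 i j)
      simp [this]
    rcases (hr0 j).eq_or_lt with hj | hj
    · have : N i j = 0 := le_antisymm (hj ▸ hNs i j ▸ hNr j i) (hN0 i j)
      simp [this]
    field_simp
  have ht1 : ∀ i, ∑ j, t i j ≤ 1 := by
    intro i
    simp only [t]
    rw [← Finset.sum_div]
    refine div_le_one_of_le₀ (le_of_sq_le_sq ?_ (hr0 i)) (hr0 i)
    refine (Finset.sum_mul_sq_le_sq_mul_sq _ _ _).trans ?_
    simp only [hN2, hr2]
    exact mul_le_of_le_one_right (Finset.sum_nonneg fun j _ => hQ0 i j) hQ1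
  let D : Fin m → Fin m → Matrix (Fin n) (Fin n) ℂ := fun i j =>
    Matrix.of fun a b => (N i j : ℂ)⁻¹ * Δ (i, a) (j, b)
  have hD : ∀ i j, ∑ a, ∑ b, ‖D i j a b‖ ^ 2 ≤ 1 := by
    intro i j
    simp only [D, of_apply, norm_mul, mul_pow, ← Finset.mul_sum]
    rw [norm_inv, Complex.norm_real, Real.norm_of_nonneg (hN0 i j), inv_pow, hN2]
    exact inv_mul_le_one_of_le₀ le_rfl (hQ0 i j)
  have hND : ∀ i j a b, (N i j : ℂ) * D i j a b = Δ (i, a) (j, b) := by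
    intro i j a b
    by_cases h : N i j = 0
    · have hq : Q i j = 0 := by rw [← hN2, h]; norm_num
      have h1 := (Finset.sum_eq_zero_iff_of_nonneg (fun a _ => by positivity)).1 hq a
        (Finset.mem_univ a)
      have h2 := (Finset.sum_eq_zero_iff_of_nonneg (fun b _ => by positivity)).1 h1 b
        (Finset.mem_univ b)
      have h3 : Δ (i, a) (j, b) = 0 := by simpa using h2
      simp [D, h3]
    · have h' : (N i j : ℂ) ≠ 0 := by exact_mod_cast h
      simp only [D, of_apply]
      field_simp
  have hE : ∀ i : Fin m, Separable (single i i (1 : ℂ) ⊗ₖ (1 : Matrix (Fin n) (Fin n) ℂ)) := by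
    intro i
    refine Separable.kronecker ?_ .one
    rw [← diagonal_single]
    refine PosSemidef.diagonal fun k => ?_
    by_cases h : k = i
    · subst h; simp
    · simp [h]
  have hrest := Separable.sum Finset.univ (fun i (_ : i ∈ Finset.univ) =>
    (hE i).smul (sub_nonneg.2 (ht1 i)))
  have hpairs := (Separable.sum Finset.univ (fun i (_ : i ∈ Finset.univ) =>
    Separable.sum Finset.univ (fun j (_ : j ∈ Finset.univ) =>
      separable_pair i j (ht0 i j) (ht0 j i) (hN0 i j) (htt i j) (hD i j)))).smul
    (c := 1 / 2) (by norm_num)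
  convert hrest.add hpairs using 1
  simp only [Finset.sum_add_distrib, smul_add]
  have e1 : ∑ i, ∑ j, (t j i : ℂ) • (single j j (1 : ℂ) ⊗ₖ (1 : Matrix (Fin n) (Fin n) ℂ))
      = ∑ i, ∑ j, (t i j : ℂ) • (single i i (1 : ℂ) ⊗ₖ (1 : Matrix (Fin n) (Fin n) ℂ)) :=
    Finset.sum_comm
  have e2 : ∑ i, ∑ j, (N i j : ℂ) • (single i j (1 : ℂ) ⊗ₖ D i j) = Δ := by
    ext ⟨a, c⟩ ⟨b, e⟩
    simp only [Matrix.sum_apply, Matrix.smul_apply, kroneckerMap_apply, single_apply, smul_eq_mul,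
      ite_and]
    simp [hND]
  have e3 : ∑ i, ∑ j, (N i j : ℂ) • (single j i (1 : ℂ) ⊗ₖ (D i j)ᴴ) = Δ := by
    have h := congrArg conjTranspose e2
    rw [hΔ.eq] at h
    rw [← h]
    simp only [conjTranspose_sum, conjTranspose_smul, conjTranspose_kronecker,
      conjTranspose_single, Complex.star_def, Complex.conj_ofReal, star_one]
  have e4 : (1 : Matrix (Fin m × Fin n) (Fin m × Fin n) ℂ)
      = ∑ i, single i i (1 : ℂ) ⊗ₖ (1 : Matrix (Fin n) (Fin n) ℂ) := by
    ext ⟨a, c⟩ ⟨b, e⟩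
    simp only [Matrix.sum_apply, kroneckerMap_apply, single_apply, ite_and]
    simp only [one_apply, Prod.ext_iff, ite_and]
    split_ifs <;> simp_all
  rw [e1, e2, e3, e4]
  push_cast
  simp only [sub_smul, one_smul, Finset.sum_sub_distrib, Finset.sum_smul]
  module

end Separability

theorem swapOp_isHermitian (n : ℕ) : (swapOp n).IsHermitian := by
  ext ⟨a, b⟩ ⟨c, d⟩
  simp only [swapOp, conjTranspose_apply, of_apply, apply_ite star, star_one, star_zero]
  congr 1
  simp only [eq_iff_iff]
  constructor <;> rintro ⟨rfl, rfl⟩ <;> exact ⟨rfl, rfl⟩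

theorem swapOp_mul_self (n : ℕ) : swapOp n * swapOp n = 1 := by
  ext ⟨a, b⟩ ⟨c, d⟩
  simp only [mul_apply, swapOp, of_apply, Fintype.sum_prod_type, one_apply, Prod.mk.injEq,
    ite_and]
  simp [eq_comm]

theorem sum_norm_sq_eq_trace {ι : Type*} [Fintype ι] (X : Matrix ι ι ℂ) :
    ((∑ p, ∑ q, ‖X p q‖ ^ 2 : ℝ) : ℂ) = (X * Xᴴ).trace := by
  simp only [trace, diag_apply, mul_apply, conjTranspose_apply, Complex.star_def,
    Complex.mul_conj']
  push_cast
  rfl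

/-- Werner states with `-1/n ≤ α ≤ 1/n` are absolutely separable. -/
theorem werner_absolutely_separable {n : ℕ} (hn : 2 ≤ n) (α : ℝ)
    (hα₁ : -(1 / (n : ℝ)) ≤ α) (hα₂ : α ≤ 1 / (n : ℝ)) :
    AbsolutelySeparable
      (((1 : ℂ) / ((n : ℂ) ^ 2 - (n : ℂ) * (α : ℂ))) •
        ((1 : Matrix (Fin n × Fin n) (Fin n × Fin n) ℂ) - (α : ℂ) • swapOp n)) := by
  intro U hU
  have hUU : U * Uᴴ = 1 := mem_unitaryGroup_iff.1 hU
  have hUU' : Uᴴ * U = 1 := mem_unitaryGroup_iff'.1 hU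
  have hn0 : (0 : ℝ) < n := by positivity
  have hn2 : (2 : ℝ) ≤ n := by exact_mod_cast hn
  have hαn : (n : ℝ) * α ≤ 1 := by rwa [le_div_iff₀' hn0] at hα₂
  have hαn' : -1 ≤ (n : ℝ) * α := by
    rwa [← neg_div, div_le_iff₀' hn0] at hα₁
  set H := U * swapOp n * Uᴴ with hH
  have hHh : H.IsHermitian := isHermitian_mul_mul_conjTranspose U (swapOp_isHermitian n)
  have hHH : H * H = 1 := by
    rw [hH]
    simp only [Matrix.mul_assoc]
    rw [← Matrix.mul_assoc Uᴴ, hUU', Matrix.one_mul, ← Matrix.mul_assoc (swapOp n),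
      swapOp_mul_self, Matrix.one_mul, hUU]
  set Δ := ((-α : ℝ) : ℂ) • H with hΔ
  have hΔh : Δ.IsHermitian := by
    rw [hΔ, IsHermitian, conjTranspose_smul, hHh.eq, Complex.star_def, Complex.conj_ofReal]
  have hnorm : ∑ p, ∑ q, ‖Δ p q‖ ^ 2 ≤ 1 := by
    have h : ∑ p, ∑ q, ‖Δ p q‖ ^ 2 = (n * α) ^ 2 := by
      have h1 := sum_norm_sq_eq_trace Δ
      rw [hΔh.eq, hΔ, smul_mul_smul, hHH, trace_smul, trace_one] at h1
      rw [hΔ]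
      have h2 : ((∑ p, ∑ q, ‖((((-α : ℝ) : ℂ) • H) p q)‖ ^ 2 : ℝ) : ℂ)
          = (((n * α) ^ 2 : ℝ) : ℂ) := by
        rw [h1]
        simp only [Fintype.card_prod, Fintype.card_fin, smul_eq_mul]
        push_cast
        ring
      exact_mod_cast h2
    rw [h]
    nlinarith
  have hc : 0 ≤ 1 / ((n : ℝ) ^ 2 - n * α) := by
    apply one_div_nonneg.2
    nlinarith
  have h := (separable_one_add hΔh hnorm).smul hc
  convert h using 1
  rw [hΔ, hH, Matrix.mul_smul, Matrix.smul_mul, Matrix.mul_sub, Matrix.sub_mul, Matrix.mul_one,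
    hUU, Matrix.mul_smul, Matrix.smul_mul]
  push_cast
  rw [neg_smul, ← sub_eq_add_neg]

end
end
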